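/- Let X be an infinite dimensional Banach space with a normalized unconditional Schauder basis (x_n), let m ∈ ℕ, q > 0, and let Y be a Banach space. Suppose every continuous m-homogeneous polynomial from X into Y is absolutely (q;1)-summing. If either (i) q < 1, Y is nonzero and finite dimensional, or (ii) Y is infinite dimensional and there exists s > max(q, 2−1) with s ≥ 2, s > q, such that Y does not have cotype s, then for every t > q and every x = ∑_j a_j x_j ∈ X one has ∑_j |a_j|^{mt} < ∞. -/

import Mathlib

open scoped BigOperators

/-- A sequence in a normed space is *weakly 1-summable*. -/
def WeaklySummable (𝕂 : Type*) [RCLike 𝕂] {X : Type*} [NormedAddCommGroup X]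
    [NormedSpace 𝕂 X] (x : ℕ → X) : Prop :=
  ∀ φ : X →L[𝕂] 𝕂, Summable fun j => ‖φ (x j)‖

/-- `P` is a continuous `m`-homogeneous polynomial. -/
def IsHomogPoly (𝕂 : Type*) [RCLike 𝕂] {X Y : Type*} [NormedAddCommGroup X] [NormedSpace 𝕂 X]
    [NormedAddCommGroup Y] [NormedSpace 𝕂 Y] (m : ℕ) (P : X → Y) : Prop :=
  ∃ T : ContinuousMultilinearMap 𝕂 (fun _ : Fin m => X) Y, ∀ x, P x = T fun _ => x

/-- A normed space has cotype `q` (Rademacher averages written as an average over signs). -/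
def HasCotype (X : Type*) [NormedAddCommGroup X] (q : ℝ) : Prop :=
  ∃ C : ℝ, 0 ≤ C ∧ ∀ (k : ℕ) (x : Fin k → X),
    (∑ j, ‖x j‖ ^ q) ^ (1 / q) ≤
      C * Real.sqrt ((2 ^ k : ℝ)⁻¹ *
        ∑ ε : Fin k → Bool, ‖∑ j, (if ε j then x j else -x j)‖ ^ 2)

/-- `e` is a normalized unconditional Schauder basis of `X`. -/
def IsNormalizedUncondBasis (𝕂 : Type*) [RCLike 𝕂] (X : Type*) [NormedAddCommGroup X]
    [NormedSpace 𝕂 X] (e : ℕ → X) : Prop :=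
  (∀ n, ‖e n‖ = 1) ∧
  (∀ x : X, ∃! a : ℕ → 𝕂, HasSum (fun n => a n • e n) x) ∧
  ∃ ρ : ℝ, 1 ≤ ρ ∧ ∀ (a ε : ℕ → 𝕂) (x y : X),
    (∀ n, ε n = 1 ∨ ε n = -1) →
    HasSum (fun n => a n • e n) x → HasSum (fun n => (ε n * a n) • e n) y →
    ‖y‖ ≤ ρ * ‖x‖



/-- The vector `v` or `-v`, according to a sign. -/
def signed {Y : Type*} [NormedAddCommGroup Y] (b : Bool) (v : Y) : Y := if b then v else -v

/-- The average of `‖∑ ± y j‖ ^ 2` over all choices of signs. -/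
noncomputable def radAvg {Y : Type*} [NormedAddCommGroup Y] {k : ℕ} (y : Fin k → Y) : ℝ :=
  (2 ^ k : ℝ)⁻¹ * ∑ ε : Fin k → Bool, ‖∑ j, signed (ε j) (y j)‖ ^ 2

/-- The family of signed sums of `y` over the fibres of `π`. -/
def blockSum {Y : Type*} [NormedAddCommGroup Y] {k : ℕ} (π : Fin k → Fin k)
    (ε : Fin k → Bool) (y : Fin k → Y) (i : Fin k) : Y :=
  ∑ j with π j = i, signed (ε j) (y j)

section Rademacher

variable {Y : Type*} [NormedAddCommGroup Y]

@[simp] lemma signed_zero (b : Bool) : signed b (0 : Y) = 0 := by simp [signed]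

@[simp] lemma norm_signed (b : Bool) (v : Y) : ‖signed b v‖ = ‖v‖ := by
  cases b <;> simp [signed]

lemma signed_signed (b c : Bool) (v : Y) : signed b (signed c v) = signed (c == b) v := by
  cases b <;> cases c <;> simp [signed]

lemma signed_sum {ι : Type*} (s : Finset ι) (b : Bool) (f : ι → Y) :
    signed b (∑ i ∈ s, f i) = ∑ i ∈ s, signed b (f i) := by
  cases b <;> simp [signed]

lemma signed_apply {𝕂 Z : Type*} [RCLike 𝕂] [NormedSpace 𝕂 Y] [NormedAddCommGroup Z]
    [NormedSpace 𝕂 Z] (φ : Y →L[𝕂] Z) (b : Bool) (v : Y) : φ (signed b v) = signed b (φ v) := by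
  cases b <;> simp [signed]

lemma radAvg_nonneg {k : ℕ} (y : Fin k → Y) : 0 ≤ radAvg y := by
  unfold radAvg; positivity

lemma sum_beq_sign {k : ℕ} (δ : Fin k → Bool) (F : (Fin k → Bool) → ℝ) :
    ∑ ε : Fin k → Bool, F (fun j => ε j == δ j) = ∑ ε, F ε := by
  refine Function.Bijective.sum_comp (g := F) 
    (e := fun (ε : Fin k → Bool) j => ε j == δ j) ?_
  refine Function.Involutive.bijective fun ε => ?_
  funext j
  cases h : ε j <;> cases h' : δ j <;> simp [h, h']

lemma inv_two_pow_mul_card (k : ℕ) :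
    (2 ^ k : ℝ)⁻¹ * (Finset.univ : Finset (Fin k → Bool)).card = 1 := by
  simp

lemma radAvg_eq_avg_blockSum {k : ℕ} (π : Fin k → Fin k) (y : Fin k → Y) :
    radAvg y = (2 ^ k : ℝ)⁻¹ * ∑ ε : Fin k → Bool, radAvg (blockSum π ε y) := by
  have key : ∀ ε δ : Fin k → Bool, ∑ i, signed (δ i) (blockSum π ε y i) =
      ∑ j, signed (ε j == δ (π j)) (y j) := by
    intro ε δ
    conv_rhs => rw [← Finset.sum_fiberwise (s := Finset.univ) (g := π)]
    refine Finset.sum_congr rfl fun i _ => ?_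
    rw [blockSum, signed_sum]
    refine Finset.sum_congr rfl fun j hj => ?_
    rw [signed_signed, (Finset.mem_filter.1 hj).2]
  simp only [radAvg, key]
  rw [← Finset.mul_sum, Finset.sum_comm]
  have : ∀ δ : Fin k → Bool, ∑ ε : Fin k → Bool, ‖∑ j, signed (ε j == δ (π j)) (y j)‖ ^ 2 =
      ∑ ε : Fin k → Bool, ‖∑ j, signed (ε j) (y j)‖ ^ 2 := fun δ =>
    sum_beq_sign (fun j => δ (π j)) (fun ε => ‖∑ j, signed (ε j) (y j)‖ ^ 2)
  simp only [this]
  rw [Finset.sum_const, nsmul_eq_mul, ← mul_assoc (2 ^ k : ℝ)⁻¹ (Finset.card _ : ℝ),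
    inv_two_pow_mul_card, one_mul]

lemma norm_sq_le_radAvg [NormedSpace ℝ Y] {k : ℕ} (y : Fin k → Y) (j : Fin k) :
    ‖y j‖ ^ 2 ≤ radAvg y := by
  set S : (Fin k → Bool) → Y := fun ε => ∑ i, signed (ε i) (y i) with hS
  set δ : Fin k → Bool := fun i => decide (i = j) with hδ
  have h1 : ∀ ε : Fin k → Bool, S ε + S (fun i => ε i == δ i) = (2 : ℝ) • signed (ε j) (y j) := by
    intro ε
    simp only [hS]
    rw [← Finset.sum_add_distrib, Finset.sum_eq_single j]
    · simp [hδ, two_smul]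
    · intro i _ hi
      cases h : ε i <;> simp [hδ, hi, signed]
    · simp
  have h2 : ∀ ε : Fin k → Bool,
      ‖y j‖ ^ 2 ≤ (1 / 2) * (‖S ε‖ ^ 2 + ‖S (fun i => ε i == δ i)‖ ^ 2) := by
    intro ε
    have h := norm_add_le (S ε) (S (fun i => ε i == δ i))
    rw [h1, norm_smul, norm_signed] at h
    norm_num at h
    nlinarith [sq_nonneg (‖S ε‖ - ‖S (fun i => ε i == δ i)‖), norm_nonneg (y j),
      norm_nonneg (S ε), norm_nonneg (S (fun i => ε i == δ i))]
  have h3 := Finset.sum_le_sum fun ε (_ : ε ∈ (Finset.univ : Finset (Fin k → Bool))) => h2 ε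
  rw [Finset.sum_const, nsmul_eq_mul, ← Finset.mul_sum, Finset.sum_add_distrib,
    sum_beq_sign δ (fun ε => ‖S ε‖ ^ 2)] at h3
  have h4 := mul_le_mul_of_nonneg_left h3 (by positivity : (0 : ℝ) ≤ (2 ^ k : ℝ)⁻¹)
  rw [← mul_assoc, inv_two_pow_mul_card, one_mul] at h4
  refine h4.trans (le_of_eq ?_)
  simp only [radAvg, hS]
  ring

lemma radAvg_smul [NormedSpace ℝ Y] {k : ℕ} (c : ℝ) (y : Fin k → Y) :
    radAvg (fun j => c • y j) = c ^ 2 * radAvg y := by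
  have h : ∀ ε : Fin k → Bool, ‖∑ j, signed (ε j) (c • y j)‖ ^ 2 =
      c ^ 2 * ‖∑ j, signed (ε j) (y j)‖ ^ 2 := by
    intro ε
    have : ∀ j, signed (ε j) (c • y j) = c • signed (ε j) (y j) := fun j => by
      cases h : ε j <;> simp [signed]
    simp only [this]
    rw [← Finset.smul_sum, norm_smul, mul_pow, Real.norm_eq_abs, sq_abs]
  simp only [radAvg, h]
  rw [← Finset.mul_sum]
  ring

lemma add_avg_rpow_le {ι : Type*} [Fintype ι] {p a K c : ℝ} (hp : 1 ≤ p) (ha : 0 ≤ a) (hK : 0 ≤ K)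
    (hc : 0 ≤ c) (hcard : c * (Finset.univ : Finset ι).card = 1) {w R : ι → ℝ} (hw : ∀ i, 0 ≤ w i)
    (hR : ∀ i, 0 ≤ R i) (h : ∀ i, a + w i ^ p ≤ K * R i ^ p) :
    a + (c * ∑ i, w i) ^ p ≤ K * (c * ∑ i, R i) ^ p := by
  have hp0 : 0 < p := by linarith
  have hpp : (ENNReal.ofReal p).toReal = p := ENNReal.toReal_ofReal hp0.le
  have : Fact (1 ≤ ENNReal.ofReal p) := ⟨by simpa using ENNReal.ofReal_le_ofReal hp⟩
  let v : ι → PiLp (ENNReal.ofReal p) (fun _ : Fin 2 => ℝ) :=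
    fun i => WithLp.toLp _ ![a ^ (1 / p), w i]
  have hnorm : ∀ u : ℝ, 0 ≤ u → ‖(WithLp.toLp _ ![a ^ (1 / p), u] :
      PiLp (ENNReal.ofReal p) (fun _ : Fin 2 => ℝ))‖ = (a + u ^ p) ^ (1 / p) := by
    intro u hu
    rw [PiLp.norm_eq_sum (by rw [hpp]; exact hp0)]
    simp only [hpp, Fin.sum_univ_two]
    simp only [Matrix.cons_val_zero, Matrix.cons_val_one, Real.norm_eq_abs]
    rw [abs_of_nonneg hu, abs_of_nonneg (by positivity), ← Real.rpow_mul ha,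
      one_div_mul_cancel hp0.ne', Real.rpow_one]
  have hsum : c • ∑ i, v i = WithLp.toLp _ ![a ^ (1 / p), c * ∑ i, w i] := by
    ext j
    fin_cases j
    · have : c * (Fintype.card ι : ℝ) = 1 := by simpa using hcard
      simp [v, ← mul_assoc, this]
    · simp [v]
  have hW : 0 ≤ c * ∑ i, w i := mul_nonneg hc (Finset.sum_nonneg fun i _ => hw i)
  have hRR : 0 ≤ c * ∑ i, R i := mul_nonneg hc (Finset.sum_nonneg fun i _ => hR i)
  have h1 : (a + (c * ∑ i, w i) ^ p) ^ (1 / p) ≤ K ^ (1 / p) * (c * ∑ i, R i) := by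
    rw [← hnorm _ hW, ← hsum, norm_smul, Real.norm_eq_abs, abs_of_nonneg hc]
    calc c * ‖∑ i, v i‖ ≤ c * ∑ i, ‖v i‖ := by gcongr; exact norm_sum_le _ _
      _ ≤ c * ∑ i, K ^ (1 / p) * R i := by
        gcongr with i
        simp only [v]
        rw [hnorm _ (hw i)]
        calc (a + w i ^ p) ^ (1 / p) ≤ (K * R i ^ p) ^ (1 / p) := by
              have := Real.rpow_nonneg (hw i) p
              gcongr
              exact h i
          _ = K ^ (1 / p) * R i := by
              rw [Real.mul_rpow hK (Real.rpow_nonneg (hR i) p), ← Real.rpow_mul (hR i),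
                mul_one_div_cancel hp0.ne', Real.rpow_one]
      _ = _ := by rw [← Finset.mul_sum]; ring
  have h0 : 0 ≤ a + (c * ∑ i, w i) ^ p := by positivity
  have h2 := Real.rpow_le_rpow (by positivity) h1 hp0.le
  rwa [← Real.rpow_mul h0, one_div_mul_cancel hp0.ne', Real.rpow_one,
    Real.mul_rpow (by positivity) hRR, ← Real.rpow_mul hK, one_div_mul_cancel hp0.ne',
    Real.rpow_one] at h2

end Rademacher

section FlatFamily

variable {Y : Type*} [NormedAddCommGroup Y]

lemma radAvg_singleton {k : ℕ} (y : Fin k → Y) (i : Fin k) :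
    radAvg (fun j => if j ∈ ({i} : Finset (Fin k)) then y j else 0) = ‖y i‖ ^ 2 := by
  have h : ∀ ε : Fin k → Bool,
      ‖∑ j, signed (ε j) (if j ∈ ({i} : Finset (Fin k)) then y j else 0)‖ ^ 2 = ‖y i‖ ^ 2 := by
    intro ε
    rw [Finset.sum_eq_single i]
    · simp
    · intro j _ hj
      simp [hj]
    · simp
  simp only [radAvg, h]
  rw [Finset.sum_const, nsmul_eq_mul, ← mul_assoc, inv_two_pow_mul_card, one_mul]

lemma sum_half_pow_rpow_le {s : ℝ} (hs : 1 ≤ s) (W : ℕ) :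
    ∑ l ∈ Finset.range W, (((1 : ℝ) / 2) ^ l) ^ s ≤ 2 := by
  calc ∑ l ∈ Finset.range W, (((1 : ℝ) / 2) ^ l) ^ s
      ≤ ∑ l ∈ Finset.range W, ((1 : ℝ) / 2) ^ l := by
        refine Finset.sum_le_sum fun l _ => ?_
        have h1 : ((1 : ℝ) / 2) ^ l ≤ 1 := pow_le_one₀ (by norm_num) (by norm_num)
        simpa using Real.rpow_le_rpow_of_exponent_ge (by positivity) h1 hs
    _ ≤ 2 := by
        refine ((summable_geometric_two).sum_le_tsum _ fun i _ => by positivity).trans ?_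
        exact tsum_geometric_two.le

lemma sum_norm_rpow_blockSum {k : ℕ} {s : ℝ} (hs : 0 < s) (y : Fin k → Y) (B : Finset (Fin k))
    (b : Fin k) (hb : b ∈ B) (ε : Fin k → Bool) :
    ∑ i, ‖blockSum (fun j => if j ∈ B then b else j) ε y i‖ ^ s =
      ∑ i ∈ Bᶜ, ‖y i‖ ^ s +
        (‖∑ j, signed (ε j) (if j ∈ B then y j else 0)‖ ^ 2) ^ (s / 2) := by
  rw [← Finset.sum_compl_add_sum B]
  congr 1
  · refine Finset.sum_congr rfl fun i hi => ?_
    rw [Finset.mem_compl] at hi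
    congr 1
    rw [blockSum, Finset.sum_eq_single i]
    · simp
    · intro j hj hji
      rw [Finset.mem_filter] at hj
      by_cases hjB : j ∈ B
      · have := hj.2
        simp only [hjB, if_true] at this
        exact absurd (this ▸ hb) hi
      · simp [hjB, hji] at hj
    · simp [hi]
  · rw [Finset.sum_eq_single b]
    · rw [← Real.rpow_natCast, ← Real.rpow_mul (norm_nonneg _)]
      norm_num
      congr 2
      · rw [blockSum]
        rw [Finset.sum_filter]
        refine Finset.sum_congr rfl fun j _ => ?_
        by_cases hjB : j ∈ B
        · simp [hjB]
        · have : j ≠ b := fun h => hjB (h ▸ hb)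
          simp [hjB, this]
      · ring
    · intro i hi hib
      rw [blockSum, Finset.sum_eq_zero, norm_zero, Real.zero_rpow hs.ne']
      intro j hj
      rw [Finset.mem_filter] at hj
      by_cases hjB : j ∈ B
      · simp only [hjB, if_true] at hj
        exact absurd hj.2.symm hib
      · simp only [hjB, if_false] at hj
        exact absurd (hj.2 ▸ hi) hjB
    · exact fun h => absurd hb h

lemma exists_block_of_large_radAvg [NormedSpace ℝ Y] {s : ℝ} (hs : 1 ≤ s) {k : ℕ} (y : Fin k → Y)
    {c : ℝ} (hc : 0 < c) (B : Finset (Fin k)) (hB : ∀ j ∈ B, 1 ≤ ‖c • y j‖ ∧ ‖c • y j‖ ≤ 2)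
    (h : 16 * (B.card : ℝ) ^ (2 / s) < radAvg (fun j => if j ∈ B then c • y j else 0)) :
    2 ≤ B.card ∧
      ∑ j ∈ B, ‖y j‖ ^ s ≤ radAvg (fun j => if j ∈ B then y j else 0) ^ (s / 2) := by
  have hs0 : 0 < s := by linarith
  constructor
  · by_contra hcard
    have : B.card = 0 ∨ B.card = 1 := by omega
    rcases this with h0 | h1
    · rw [Finset.card_eq_zero] at h0
      subst h0
      simp only [radAvg, Finset.card_empty, Nat.cast_zero, Finset.notMem_empty, if_false,
        signed_zero, Finset.sum_const_zero, norm_zero] at h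
      rw [Real.zero_rpow (by positivity)] at h
      simp at h
    · obtain ⟨i, rfl⟩ := Finset.card_eq_one.1 h1
      rw [radAvg_singleton (fun j => c • y j)] at h
      have h2 := (hB i (Finset.mem_singleton_self i)).2
      simp only [Finset.card_singleton, Nat.cast_one, Real.one_rpow] at h
      nlinarith [norm_nonneg (c • y i)]
  · have hsmul : (fun j => if j ∈ B then c • y j else 0) =
        fun j => c • (if j ∈ B then y j else 0) := by
      funext j
      split_ifs <;> simp
    rw [hsmul, radAvg_smul] at h
    set R := radAvg (fun j => if j ∈ B then y j else 0)
    have hR : 0 ≤ R := radAvg_nonneg _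
    have h1 : 16 / c ^ 2 * (B.card : ℝ) ^ (2 / s) ≤ R := by
      rw [div_mul_eq_mul_div, div_le_iff₀ (by positivity)]
      linarith
    have h2 := Real.rpow_le_rpow (by positivity) h1 (by positivity : 0 ≤ s / 2)
    refine le_trans ?_ h2
    rw [Real.mul_rpow (by positivity) (by positivity), ← Real.rpow_mul (by positivity),
      show 2 / s * (s / 2) = 1 by field_simp, Real.rpow_one]
    have h3 : (16 / c ^ 2) ^ (s / 2) = (4 / c) ^ s := by
      rw [show (16 : ℝ) / c ^ 2 = (4 / c) ^ (2 : ℝ) by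
        rw [Real.rpow_two]; ring, ← Real.rpow_mul (by positivity)]
      congr 1
      ring
    rw [h3]
    calc ∑ j ∈ B, ‖y j‖ ^ s ≤ ∑ j ∈ B, (4 / c) ^ s := by
          refine Finset.sum_le_sum fun j hj => ?_
          refine Real.rpow_le_rpow (norm_nonneg _) ?_ hs0.le
          have := (hB j hj).2
          rw [norm_smul, Real.norm_eq_abs, abs_of_pos hc] at this
          rw [le_div_iff₀ hc]
          linarith
      _ = _ := by rw [Finset.sum_const, nsmul_eq_mul, mul_comm]

/-- If `Y` fails cotype `s`, there are arbitrarily large families of vectors of norm between `1` and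
`2` all of whose subfamilies have Rademacher averages satisfying an upper `s`-estimate. -/
lemma exists_flat_family [NormedSpace ℝ Y] {s : ℝ} (hs : 2 ≤ s) (h : ¬HasCotype Y s) (N : ℕ) :
    ∃ (k : ℕ) (y : Fin k → Y) (A : Finset (Fin k)), N ≤ A.card ∧
      (∀ j ∈ A, 1 ≤ ‖y j‖ ∧ ‖y j‖ ≤ 2) ∧
      ∀ B ⊆ A, radAvg (fun j => if j ∈ B then y j else 0) ≤ 16 * (B.card : ℝ) ^ (2 / s) := by
  classical
  by_contra! hQ
  have hs0 : 0 < s := by linarith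
  have claim : ∀ (k n : ℕ) (y : Fin k → Y), (Finset.univ.filter fun j => y j ≠ 0).card = n →
      ∑ j, ‖y j‖ ^ s ≤ 2 * N * radAvg y ^ (s / 2) := by
    intro k n
    induction n using Nat.strong_induction_on with
    | _ n ih =>
    intro y hn
    by_cases hgood : ∃ B ⊆ Finset.univ.filter (fun j => y j ≠ 0), 2 ≤ B.card ∧
        ∑ j ∈ B, ‖y j‖ ^ s ≤ radAvg (fun j => if j ∈ B then y j else 0) ^ (s / 2)
    · obtain ⟨B, hBsupp, hcard, hBsum⟩ := hgood
      obtain ⟨b, hb, b', hb', hbb'⟩ := Finset.one_lt_card.1 hcard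
      set π : Fin k → Fin k := fun j => if j ∈ B then b else j with hπ
      have hind : ∀ ε : Fin k → Bool, ∑ i ∈ Bᶜ, ‖y i‖ ^ s +
          (‖∑ j, signed (ε j) (if j ∈ B then y j else 0)‖ ^ 2) ^ (s / 2) ≤
          2 * N * radAvg (blockSum π ε y) ^ (s / 2) := by
        intro ε
        rw [← sum_norm_rpow_blockSum hs0 y B b hb ε]
        refine ih _ ?_ _ rfl
        rw [← hn]
        refine Finset.card_lt_card ⟨fun i hi => ?_, fun hsub => ?_⟩
        · rw [Finset.mem_filter] at hi ⊢
          refine ⟨Finset.mem_univ _, fun hy => hi.2 ?_⟩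
          rw [blockSum]
          refine Finset.sum_eq_zero fun j hj => ?_
          rw [Finset.mem_filter] at hj
          by_cases hjB : j ∈ B
          · simp only [hjB, if_true] at hj
            have := (Finset.mem_filter.1 (hBsupp hb)).2
            exact absurd hy (hj.2 ▸ this)
          · simp only [hjB, if_false] at hj
            rw [hj.2, hy, signed_zero]
        · refine (Finset.mem_filter.1 (hsub (hBsupp hb'))).2 ?_
          rw [blockSum]
          refine Finset.sum_eq_zero fun j hj => ?_
          rw [Finset.mem_filter] at hj
          by_cases hjB : j ∈ B
          · simp only [hjB, if_true] at hj
            exact absurd hj.2 hbb'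
          · simp only [hjB, if_false] at hj
            exact absurd (hj.2 ▸ hb') hjB
      have := add_avg_rpow_le (p := s / 2) (a := ∑ i ∈ Bᶜ, ‖y i‖ ^ s) (K := 2 * N)
        (by linarith) (by positivity) (by positivity) (by positivity) (inv_two_pow_mul_card k)
        (fun ε => by positivity) (fun ε => radAvg_nonneg (blockSum π ε y)) hind
      rw [← radAvg_eq_avg_blockSum] at this
      rw [← Finset.sum_compl_add_sum B]
      exact le_trans (add_le_add le_rfl hBsum) this
    · push Not at hgood
      set M : ℝ := Real.sqrt (radAvg y) with hM
      have hM0 : 0 ≤ M := Real.sqrt_nonneg _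
      have hyM : ∀ j, ‖y j‖ ≤ M := fun j => Real.le_sqrt_of_sq_le (norm_sq_le_radAvg y j)
      have hMs : radAvg y ^ (s / 2) = M ^ s := by
        rw [hM, Real.sqrt_eq_rpow, ← Real.rpow_mul (radAvg_nonneg _)]
        congr 1
        ring
      rw [hMs]
      have hlev : ∀ j, ∃ l : ℕ, y j ≠ 0 → M * (1 / 2) ^ (l + 1) < ‖y j‖ ∧
          ‖y j‖ ≤ M * (1 / 2) ^ l := by
        intro j
        by_cases hj : y j = 0
        · exact ⟨0, fun h => absurd hj h⟩
        · have hpos : 0 < ‖y j‖ := norm_pos_iff.2 hj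
          have hMpos : 0 < M := hpos.trans_le (hyM j)
          obtain ⟨l, h1, h2⟩ := exists_nat_pow_near_of_lt_one (div_pos hpos hMpos)
            ((div_le_one hMpos).2 (hyM j)) (by norm_num : (0 : ℝ) < 1 / 2) (by norm_num)
          refine ⟨l, fun _ => ⟨?_, ?_⟩⟩
          · rw [lt_div_iff₀ hMpos] at h1; linarith
          · rw [div_le_iff₀ hMpos] at h2; linarith
      choose l hl using hlev
      set supp := Finset.univ.filter fun j => y j ≠ 0 with hsupp
      have hfib : ∀ i, (supp.filter fun j => l j = i).card ≤ N := by
        intro i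
        by_contra! hcon
        obtain ⟨j₀, hj₀⟩ := Finset.card_pos.1 (lt_of_le_of_lt (Nat.zero_le _) hcon)
        rw [Finset.mem_filter, hsupp, Finset.mem_filter] at hj₀
        have hMpos : 0 < M := (norm_pos_iff.2 hj₀.1.2).trans_le (hyM j₀)
        set c : ℝ := 2 ^ (i + 1) / M with hc
        have hcpos : 0 < c := by positivity
        have hwin : ∀ j ∈ supp.filter (fun j => l j = i), 1 ≤ ‖c • y j‖ ∧ ‖c • y j‖ ≤ 2 := by
          intro j hj
          rw [Finset.mem_filter, hsupp, Finset.mem_filter] at hj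
          obtain ⟨h1, h2⟩ := hl j hj.1.2
          rw [hj.2] at h1 h2
          rw [norm_smul, Real.norm_eq_abs, abs_of_pos hcpos]
          have e1 : c * (M * (1 / 2) ^ (i + 1)) = 1 := by
            rw [hc, one_div, inv_pow]; field_simp
          have e2 : c * (M * (1 / 2) ^ i) = 2 := by
            rw [hc, one_div, inv_pow]; field_simp; ring
          exact ⟨e1 ▸ mul_le_mul_of_nonneg_left h1.le hcpos.le,
            e2 ▸ mul_le_mul_of_nonneg_left h2 hcpos.le⟩
        obtain ⟨B, hBA, hB⟩ := hQ k (fun j => c • y j) _ hcon.le hwin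
        obtain ⟨g1, g2⟩ := exists_block_of_large_radAvg (by linarith) y hcpos B
          (fun j hj => hwin j (hBA hj)) hB
        exact absurd g2 (not_le.2 (hgood B (hBA.trans (Finset.filter_subset _ _)) g1))
      have hsum : ∑ j, ‖y j‖ ^ s = ∑ j ∈ supp, ‖y j‖ ^ s := by
        rw [hsupp, Finset.sum_filter]
        refine Finset.sum_congr rfl fun j _ => ?_
        by_cases hj : y j = 0
        · simp [hj, hs0.ne']
        · simp [hj]
      set W := (supp.sup l) + 1 with hW
      rw [hsum, ← Finset.sum_fiberwise_of_maps_to (t := Finset.range W) (g := l)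
        (fun j hj => Finset.mem_range.2 (Nat.lt_succ_of_le (Finset.le_sup hj)))]
      calc ∑ i ∈ Finset.range W, ∑ j ∈ supp with l j = i, ‖y j‖ ^ s
          ≤ ∑ i ∈ Finset.range W, N * (M ^ s * ((1 / 2) ^ i) ^ s) := by
            refine Finset.sum_le_sum fun i _ => ?_
            rw [← Real.mul_rpow hM0 (by positivity)]
            calc ∑ j ∈ supp with l j = i, ‖y j‖ ^ s
                ≤ ∑ j ∈ supp with l j = i, (M * (1 / 2) ^ i) ^ s := by
                  refine Finset.sum_le_sum fun j hj => ?_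
                  rw [Finset.mem_filter, hsupp, Finset.mem_filter] at hj
                  refine Real.rpow_le_rpow (norm_nonneg _) ?_ hs0.le
                  exact hj.2 ▸ (hl j hj.1.2).2
              _ ≤ N * (M * (1 / 2) ^ i) ^ s := by
                  rw [Finset.sum_const, nsmul_eq_mul]
                  have : (((supp.filter fun j => l j = i).card : ℕ) : ℝ) ≤ N := by
                    exact_mod_cast hfib i
                  gcongr
        _ = N * M ^ s * ∑ i ∈ Finset.range W, (((1 : ℝ) / 2) ^ i) ^ s := by
            rw [Finset.mul_sum]
            exact Finset.sum_congr rfl fun i _ => by ring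
        _ ≤ N * M ^ s * 2 := by
            have := sum_half_pow_rpow_le (by linarith : 1 ≤ s) W
            have := Real.rpow_nonneg hM0 s
            gcongr
        _ = _ := by ring
  refine h ⟨(2 * N : ℝ) ^ (1 / s), by positivity, fun k y => ?_⟩
  change _ ≤ _ * Real.sqrt (radAvg y)
  calc (∑ j, ‖y j‖ ^ s) ^ (1 / s) ≤ (2 * N * radAvg y ^ (s / 2)) ^ (1 / s) := by
        refine Real.rpow_le_rpow (by positivity) (claim k _ y rfl) (by positivity)
    _ = _ := by
        have hR := radAvg_nonneg y
        rw [Real.mul_rpow (by positivity) (by positivity), ← Real.rpow_mul hR, Real.sqrt_eq_rpow]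
        congr 2
        field_simp

end FlatFamily


lemma exists_min_homogeneous {κ : Type*} (k : ℕ)
    (ih : ∀ M : ℕ, ∃ N : ℕ, ∀ (α : Type) [LinearOrder α] (A : Finset α), N ≤ A.card →
      ∀ c : Finset α → κ, ∃ H ⊆ A, H.card = M ∧ ∃ col, ∀ S ⊆ H, S.card = k → c S = col) (L : ℕ) :
    ∃ N : ℕ, ∀ (α : Type) [LinearOrder α] (A : Finset α), N ≤ A.card → ∀ c : Finset α → κ,
      ∃ H ⊆ A, H.card = L ∧ ∃ d : α → κ, ∀ x ∈ H, ∀ S ⊆ H, (∀ y ∈ S, x < y) → S.card = k →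
        c (insert x S) = d x := by
  induction L with
  | zero =>
    exact ⟨0, fun α _ A _ c => ⟨∅, Finset.empty_subset _, rfl, fun _ => c ∅, by simp⟩⟩
  | succ L ihL =>
    obtain ⟨N₁, hN₁⟩ := ihL
    obtain ⟨N₂, hN₂⟩ := ih N₁
    refine ⟨N₂ + 1, fun α _ A hA c => ?_⟩
    have hne : A.Nonempty := Finset.card_pos.1 (by omega)
    set x := A.min' hne
    have hxA : x ∈ A := A.min'_mem hne
    obtain ⟨H', hH'A, hH'card, col, hcol⟩ := hN₂ α (A.erase x)
      (by rw [Finset.card_erase_of_mem hxA]; omega) (fun S => c (insert x S))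
    obtain ⟨H, hHH', hHcard, d, hd⟩ := hN₁ α H' hH'card.ge c
    have hlt : ∀ y ∈ H, x < y := fun y hy => by
      have := Finset.mem_erase.1 (hH'A (hHH' hy))
      exact lt_of_le_of_ne (A.min'_le y this.2) this.1.symm
    have hxH : x ∉ H := fun h => lt_irrefl x (hlt x h)
    refine ⟨insert x H, ?_, ?_, Function.update d x col, ?_⟩
    · intro y hy
      rcases Finset.mem_insert.1 hy with rfl | hy
      · exact hxA
      · exact Finset.mem_of_mem_erase (hH'A (hHH' hy))
    · rw [Finset.card_insert_of_notMem hxH, hHcard]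
    · intro y hy S hS hyS hcard
      have hSH : S ⊆ H := fun z hz => by
        rcases Finset.mem_insert.1 (hS hz) with rfl | h
        · rcases Finset.mem_insert.1 hy with rfl | hy
          · exact absurd (hyS _ hz) (lt_irrefl _)
          · exact absurd (hyS _ hz) (hlt y hy).asymm
        · exact h
      rcases Finset.mem_insert.1 hy with rfl | hy
      · rw [Function.update_self]
        exact hcol S (hSH.trans hHH') hcard
      · rw [Function.update_of_ne (hlt y hy).ne']
        exact hd y hy S hSH hyS hcard

/-- The finite Ramsey theorem for colourings of `k`-element sets. -/
lemma exists_homogeneous {κ : Type*} [Finite κ] (k : ℕ) :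
    ∀ M : ℕ, ∃ N : ℕ, ∀ (α : Type) [LinearOrder α] (A : Finset α), N ≤ A.card → ∀ c : Finset α → κ,
      ∃ H ⊆ A, H.card = M ∧ ∃ col, ∀ S ⊆ H, S.card = k → c S = col := by
  classical
  have := Fintype.ofFinite κ
  induction k with
  | zero =>
    refine fun M => ⟨M, fun α _ A hA c => ?_⟩
    obtain ⟨H, hHA, hH⟩ := Finset.exists_subset_card_eq hA
    exact ⟨H, hHA, hH, c ∅, fun S _ hS => by rw [Finset.card_eq_zero.1 hS]⟩
  | succ k ih =>
    intro M
    obtain ⟨N, hN⟩ := exists_min_homogeneous k ih (Fintype.card κ * M + 1)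
    refine ⟨N, fun α _ A hA c => ?_⟩
    obtain ⟨H, hHA, hH, d, hd⟩ := hN α A hA c
    obtain ⟨col, -, hcol⟩ := Finset.exists_lt_card_fiber_of_mul_lt_card_of_maps_to
      (s := H) (t := Finset.univ) (f := d) (n := M) (fun _ _ => Finset.mem_univ _)
      (by rw [hH, Finset.card_univ]; omega)
    obtain ⟨G, hG, hGcard⟩ := Finset.exists_subset_card_eq hcol.le
    refine ⟨G, hG.trans ((Finset.filter_subset _ _).trans hHA), hGcard, col, fun S hS hcard => ?_⟩
    have hne : S.Nonempty := Finset.card_pos.1 (by omega)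
    have hx := S.min'_mem hne
    have hSH : S ⊆ H := hS.trans (hG.trans (Finset.filter_subset _ _))
    have := hd _ (hSH hx) (S.erase (S.min' hne)) ((Finset.erase_subset _ _).trans hSH)
      (fun y hy => lt_of_le_of_ne (S.min'_le y (Finset.mem_of_mem_erase hy))
        (Finset.ne_of_mem_erase hy).symm) (by rw [Finset.card_erase_of_mem hx]; omega)
    rw [Finset.insert_erase hx] at this
    rw [this]
    exact (Finset.mem_filter.1 (hG (hS hx))).2

section SubsetSums

variable {Y : Type*} [NormedAddCommGroup Y]

lemma exists_signs_of_radAvg_le {k : ℕ} (y : Fin k → Y) {t : ℝ} (h : radAvg y ≤ t) :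
    ∃ ε : Fin k → Bool, ‖∑ j, signed (ε j) (y j)‖ ^ 2 ≤ t := by
  by_contra! hcon
  have h1 := Finset.sum_lt_sum_of_nonempty
    (Finset.univ_nonempty (α := Fin k → Bool)) fun ε _ => hcon ε
  rw [Finset.sum_const, nsmul_eq_mul] at h1
  have h2 := mul_lt_mul_of_pos_left h1 (by positivity : (0 : ℝ) < (2 ^ k : ℝ)⁻¹)
  rw [← mul_assoc, inv_two_pow_mul_card, one_mul] at h2
  exact absurd h2 (not_lt.2 h)

lemma radAvg_real {k : ℕ} (c : Fin k → ℝ) : radAvg c = ∑ j, c j ^ 2 := by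
  have h1 : ∀ ε : Fin k → Bool, ‖∑ j, signed (ε j) (c j)‖ ^ 2 =
      ∑ i, ∑ j, signed (ε i) (c i) * signed (ε j) (c j) := by
    intro ε
    rw [Real.norm_eq_abs, sq_abs, sq, Finset.sum_mul_sum]
  have h2 : ∀ i j, ∑ ε : Fin k → Bool, signed (ε i) (c i) * signed (ε j) (c j) =
      if i = j then 2 ^ k * c i ^ 2 else 0 := by
    intro i j
    split_ifs with hij
    · subst hij
      have : ∀ ε : Fin k → Bool, signed (ε i) (c i) * signed (ε i) (c i) = c i ^ 2 := by
        intro ε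
        cases h : ε i <;> simp [signed, sq]
      simp [this]
    · have h3 := sum_beq_sign (fun l => decide (l ≠ i))
        (fun ε : Fin k → Bool => signed (ε i) (c i) * signed (ε j) (c j))
      have h4 : ∀ ε : Fin k → Bool,
          signed (ε i == decide (i ≠ i)) (c i) * signed (ε j == decide (j ≠ i)) (c j) =
          -(signed (ε i) (c i) * signed (ε j) (c j)) := by
        intro ε
        have : j ≠ i := fun h => hij h.symm
        cases h : ε i <;> cases h' : ε j <;> simp [signed, this]
      simp only [h4, Finset.sum_neg_distrib] at h3
      linarith
  simp only [radAvg, h1]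
  rw [Finset.sum_comm]
  simp_rw [Finset.sum_comm (s := (Finset.univ : Finset (Fin k → Bool))), h2]
  simp [Finset.mul_sum]

lemma radAvg_apply_le [NormedSpace ℝ Y] {k : ℕ} (φ : Y →L[ℝ] ℝ) (hφ : ‖φ‖ ≤ 1) (y : Fin k → Y) :
    radAvg (fun j => φ (y j)) ≤ radAvg y := by
  unfold radAvg
  gcongr with ε
  rw [show ∑ j, signed (ε j) (φ (y j)) = φ (∑ j, signed (ε j) (y j)) by
    rw [map_sum]; simp only [signed_apply]]
  exact (φ.le_of_opNorm_le hφ _).trans (by rw [one_mul])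

lemma exists_separated_pair [NormedSpace ℝ Y] {s : ℝ} (hs : 2 < s) :
    ∃ b : ℕ, ∀ {k : ℕ} (y : Fin k → Y) (B : Finset (Fin k)), B.card = b → (∀ j ∈ B, 1 ≤ ‖y j‖) →
      radAvg (fun j => if j ∈ B then y j else 0) ≤ 16 * (B.card : ℝ) ^ (2 / s) →
      ∃ u ∈ B, ∃ v ∈ B, 1 / 2 ≤ ‖y u - y v‖ := by
  have hpos : 0 < 1 - 2 / s := by
    rw [sub_pos, div_lt_one (by linarith)]; exact hs
  obtain ⟨b, hb⟩ := (((tendsto_rpow_atTop hpos).comp tendsto_natCast_atTop_atTop).eventually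
    (Filter.eventually_gt_atTop (64 : ℝ))).and (Filter.eventually_gt_atTop 0) |>.exists
  refine ⟨b, fun {k} y B hcard hnorm hrad => ?_⟩
  by_contra! hcon
  have hb0 : 0 < (b : ℝ) := by exact_mod_cast hb.2
  obtain ⟨u, hu⟩ := Finset.card_pos.1 (hcard ▸ hb.2)
  obtain ⟨φ, hφ, hφu⟩ := exists_dual_vector'' ℝ (y u)
  have h1 := radAvg_apply_le φ hφ (fun j => if j ∈ B then y j else 0)
  rw [radAvg_real] at h1
  have h2 : (b : ℝ) * (1 / 4) ≤ ∑ j, φ (if j ∈ B then y j else 0) ^ 2 := by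
    calc (b : ℝ) * (1 / 4) = ∑ j ∈ B, (1 / 4 : ℝ) := by
          rw [Finset.sum_const, nsmul_eq_mul, hcard]
      _ ≤ ∑ j ∈ B, φ (if j ∈ B then y j else 0) ^ 2 := by
          refine Finset.sum_le_sum fun j hj => ?_
          rw [if_pos hj]
          have h3 : φ (y u) - φ (y j) ≤ 1 / 2 := by
            rw [← map_sub]
            refine (le_abs_self _).trans ?_
            refine (φ.le_of_opNorm_le hφ _).trans ?_
            rw [one_mul]
            exact (hcon u hu j hj).le
          have h4 : φ (y u) = ‖y u‖ := hφu
          have h5 := hnorm u hu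
          nlinarith
      _ ≤ _ := Finset.sum_le_sum_of_subset_of_nonneg (Finset.subset_univ _)
          fun _ _ _ => sq_nonneg _
  have h6 : (b : ℝ) * (1 / 4) ≤ 16 * (b : ℝ) ^ (2 / s) := by
    rw [← hcard] at h2 ⊢
    linarith
  have h7 : (b : ℝ) = (b : ℝ) ^ (1 - 2 / s) * (b : ℝ) ^ (2 / s) := by
    rw [← Real.rpow_add hb0]; simp
  have h8 : 64 < (b : ℝ) ^ (1 - 2 / s) := hb.1
  have h9 : 0 < (b : ℝ) ^ (2 / s) := by positivity
  nlinarith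

lemma exists_signs_restrict {k n : ℕ} {s : ℝ} (y : Fin k → Y) {A : Finset (Fin k)}
    (hA : ∀ B ⊆ A, radAvg (fun j => if j ∈ B then y j else 0) ≤ 16 * (B.card : ℝ) ^ (2 / s))
    (τ : Fin n ↪o Fin k) (hτ : ∀ i, τ i ∈ A) (I : Finset (Fin n)) :
    ∃ ε : Fin n → Bool, ‖∑ i ∈ I, signed (ε i) (y (τ i))‖ ≤ 4 * (I.card : ℝ) ^ (1 / s) := by
  obtain ⟨ε, hε⟩ := exists_signs_of_radAvg_le _ (hA (I.map τ.toEmbedding) (fun j hj => by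
    obtain ⟨i, -, rfl⟩ := Finset.mem_map.1 hj
    exact hτ i))
  refine ⟨fun i => ε (τ i), ?_⟩
  have h1 : ∑ j, signed (ε j) (if j ∈ I.map τ.toEmbedding then y j else 0) =
      ∑ i ∈ I, signed (ε (τ i)) (y (τ i)) := by
    rw [← Finset.sum_subset (Finset.subset_univ (I.map τ.toEmbedding)), Finset.sum_map]
    · exact Finset.sum_congr rfl fun i hi => by simp [hi]
    · intro j _ hj
      rw [if_neg hj, signed_zero]
  rw [h1, Finset.card_map] at hε
  refine (pow_le_pow_iff_left₀ (norm_nonneg _) (by positivity) two_ne_zero).1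
    (hε.trans (le_of_eq ?_))
  rw [mul_pow, ← Real.rpow_mul_natCast (by positivity)]
  norm_num
  congr 1
  ring

/-- If `Y` fails cotype `s > 2`, there are arbitrarily large families of vectors bounded away from
zero whose subset sums satisfy an upper `s`-estimate. -/
lemma exists_upper_estimate_subset_sums [NormedSpace ℝ Y] {s : ℝ} (hs : 2 < s)
    (h : ¬HasCotype Y s) (n : ℕ) :
    ∃ d : Fin n → Y, (∀ i, 1 / 2 ≤ ‖d i‖) ∧
      ∀ I : Finset (Fin n), ‖∑ i ∈ I, d i‖ ≤ 16 * (I.card : ℝ) ^ (1 / s) := by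
  classical
  obtain ⟨b, hb⟩ := exists_separated_pair (Y := Y) hs
  obtain ⟨N, hN⟩ := exists_homogeneous (κ := Finset (Fin n) → Fin n → Bool) n (n * b)
  obtain ⟨k, y, A, hNA, hnorm, hA⟩ := exists_flat_family hs.le h N
  have hcol : ∀ S : Finset (Fin k), ∃ c : Finset (Fin n) → Fin n → Bool,
      ∀ hS : S ⊆ A ∧ S.card = n, ∀ I : Finset (Fin n),
        ‖∑ i ∈ I, signed (c I i) (y (S.orderEmbOfFin hS.2 i))‖ ≤ 4 * (I.card : ℝ) ^ (1 / s) := by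
    intro S
    by_cases hS : S ⊆ A ∧ S.card = n
    · choose c hc using exists_signs_restrict (s := s) y hA (S.orderEmbOfFin hS.2)
        (fun i => hS.1 (Finset.orderEmbOfFin_mem S hS.2 i))
      exact ⟨c, fun _ => hc⟩
    · exact ⟨fun _ _ => true, fun hS' => absurd hS' hS⟩
  choose c hc using hcol
  obtain ⟨H, hHA, hHcard, κ, hκ⟩ := hN (Fin k) A hNA c
  have htrans : ∀ τ : Fin n → Fin k, StrictMono τ → (∀ i, τ i ∈ H) → ∀ I : Finset (Fin n),
      ‖∑ i ∈ I, signed (κ I i) (y (τ i))‖ ≤ 4 * (I.card : ℝ) ^ (1 / s) := by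
    intro τ hτ hτH I
    set S := Finset.univ.image τ
    have hScard : S.card = n := by
      rw [Finset.card_image_of_injective _ hτ.injective, Finset.card_univ, Fintype.card_fin]
    have hSH : S ⊆ H := by
      intro j hj
      obtain ⟨i, -, rfl⟩ := Finset.mem_image.1 hj
      exact hτH i
    have h1 := hc S ⟨hSH.trans hHA, hScard⟩ I
    rw [hκ S hSH hScard, ← Finset.orderEmbOfFin_unique hScard
      (fun i => Finset.mem_image_of_mem _ (Finset.mem_univ i)) hτ] at h1
    exact h1
  set g : Fin n → Fin b → Fin k := fun i u => H.orderEmbOfFin hHcard (finProdFinEquiv (i, u))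
    with hg
  have hgH : ∀ i u, g i u ∈ H := fun i u => Finset.orderEmbOfFin_mem H hHcard _
  have hglt : ∀ i i' u u', i < i' → g i u < g i' u' := by
    intro i i' u u' hii
    rw [hg]
    refine (H.orderEmbOfFin hHcard).strictMono ?_
    rw [Fin.lt_def]
    simp only [finProdFinEquiv_apply_val]
    have h1 := u.2
    have h2 : (i : ℕ) + 1 ≤ i' := hii
    nlinarith [Nat.mul_le_mul_left b h2]
  have hpair : ∀ i, ∃ p : Bool → Fin b, 1 / 2 ≤ ‖y (g i (p true)) - y (g i (p false))‖ := by
    intro i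
    have hinj : Function.Injective (g i) := by
      intro u u' huu
      have := finProdFinEquiv.injective ((H.orderEmbOfFin hHcard).injective huu)
      exact (Prod.ext_iff.1 this).2
    have hsub : Finset.univ.image (g i) ⊆ A := by
      intro j hj
      obtain ⟨u, -, rfl⟩ := Finset.mem_image.1 hj
      exact hHA (hgH i u)
    obtain ⟨u, hu, v, hv, huv⟩ := hb y (Finset.univ.image (g i))
      (by rw [Finset.card_image_of_injective _ hinj, Finset.card_univ, Fintype.card_fin])
      (fun j hj => (hnorm j (hsub hj)).1) (hA _ hsub)
    obtain ⟨u, -, rfl⟩ := Finset.mem_image.1 hu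
    obtain ⟨v, -, rfl⟩ := Finset.mem_image.1 hv
    exact ⟨fun t => if t then u else v, by simpa using huv⟩
  choose p hp using hpair
  have hτ : ∀ (w : Fin n → Bool) (I : Finset (Fin n)),
      ‖∑ i ∈ I, signed (κ I i) (y (g i (p i (w i))))‖ ≤ 4 * (I.card : ℝ) ^ (1 / s) := fun w =>
    htrans (fun i => g i (p i (w i))) (fun i i' hii => hglt _ _ _ _ hii) (fun i => hgH _ _)
  set d : Fin n → Y := fun i => y (g i (p i true)) - y (g i (p i false)) with hd
  refine ⟨d, hp, fun I => ?_⟩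
  have hpart : ∀ t : Bool, ‖∑ i ∈ I with κ I i = t, d i‖ ≤ 8 * (I.card : ℝ) ^ (1 / s) := by
    intro t
    have h1 := hτ (fun _ => true) I
    have h2 := hτ (fun i => !decide (κ I i = t)) I
    have h3 : ∑ i ∈ I, signed (κ I i) (y (g i (p i true))) -
        ∑ i ∈ I, signed (κ I i) (y (g i (p i (!decide (κ I i = t))))) =
        signed t (∑ i ∈ I with κ I i = t, d i) := by
      rw [signed_sum, Finset.sum_filter, ← Finset.sum_sub_distrib]
      refine Finset.sum_congr rfl fun i _ => ?_
      by_cases hi : κ I i = t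
      · rw [if_pos hi, hi]
        cases t <;> simp [signed, hd]
        abel
      · simp [hi]
    have h4 := norm_sub_le (∑ i ∈ I, signed (κ I i) (y (g i (p i true))))
      (∑ i ∈ I, signed (κ I i) (y (g i (p i (!decide (κ I i = t))))))
    rw [h3, norm_signed] at h4
    linarith
  have h5 : ∑ i ∈ I, d i = ∑ i ∈ I with κ I i = true, d i + ∑ i ∈ I with κ I i = false, d i := by
    rw [← Finset.sum_filter_add_sum_filter_not I (fun i => κ I i = true)]
    simp
  rw [h5]
  refine (norm_add_le _ _).trans ?_
  linarith [hpart true, hpart false]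

end SubsetSums

/-- Families of every length in `Y`, bounded below in norm, whose linear combinations with
coefficients in the unit ball of `ℓ_∞` are controlled by the power `1 / s` of the `q`-th power sum
of the coefficients, for some `s > q`. -/
def HasUpperFamilies (𝕂 : Type*) [RCLike 𝕂] (Y : Type*) [NormedAddCommGroup Y] [NormedSpace 𝕂 Y]
    (q : ℝ) : Prop :=
  ∃ s C : ℝ, q < s ∧ 0 ≤ C ∧ ∀ n : ℕ, ∃ y : Fin n → Y, (∀ j, 1 ≤ ‖y j‖) ∧
    ∀ (b : Fin n → 𝕂) (S : ℝ), (∀ j, ‖b j‖ ≤ 1) → ∑ j, ‖b j‖ ^ q ≤ S →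
      ‖∑ j, b j • y j‖ ≤ C * S ^ (1 / s)

section UpperFamilies

variable {𝕂 : Type*} [RCLike 𝕂] {Y : Type*} [NormedAddCommGroup Y] [NormedSpace 𝕂 Y]

lemma hasUpperFamilies_of_lt_one [Nontrivial Y] {q : ℝ} (hq : 0 < q) (hq1 : q < 1) :
    HasUpperFamilies 𝕂 Y q := by
  obtain ⟨v, hv⟩ := exists_ne (0 : Y)
  obtain ⟨u, hu⟩ : ∃ u : Y, ‖u‖ = 1 := ⟨((‖v‖⁻¹ : ℝ) : 𝕂) • v, by
    rw [norm_smul, RCLike.norm_ofReal, abs_of_nonneg (by positivity),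
      inv_mul_cancel₀ (norm_ne_zero_iff.2 hv)]⟩
  refine ⟨1, 1, hq1, zero_le_one, fun n => ⟨fun _ => u, fun _ => hu.ge, fun b S hb hS => ?_⟩⟩
  rw [div_one, Real.rpow_one, one_mul]
  refine (norm_sum_le _ _).trans ((Finset.sum_le_sum fun j _ => ?_).trans hS)
  rw [norm_smul, hu, mul_one]
  simpa using Real.rpow_le_rpow_of_exponent_ge' (norm_nonneg (b j)) (hb j) hq.le hq1.le

/-- Layer-cake summation: an upper estimate on subset sums passes to coefficients in `[0, 1]`. -/
lemma norm_sum_smul_le_of_subset_sums [NormedSpace ℝ Y] [CompleteSpace Y] {q s K : ℝ}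
    (hq : 0 < q) (hqs : q < s) (hK : 0 ≤ K) {n : ℕ} (d : Fin n → Y)
    (hd : ∀ I : Finset (Fin n), ‖∑ i ∈ I, d i‖ ≤ K * (I.card : ℝ) ^ (1 / s))
    (b : Fin n → ℝ) (hb0 : ∀ i, 0 ≤ b i) (hb1 : ∀ i, b i ≤ 1) {S : ℝ} (hS : ∑ i, b i ^ q ≤ S) :
    ‖∑ i, b i • d i‖ ≤ K / (1 - q / s) * S ^ (1 / s) := by
  have hs : 0 < s := hq.trans hqs
  have hS0 : 0 ≤ S := (Finset.sum_nonneg fun i _ => Real.rpow_nonneg (hb0 i) q).trans hS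
  have hcoef : ∀ i, b i • d i = ∫ t in (0 : ℝ)..1, (Set.Iio (b i)).indicator (fun _ => d i) t := by
    intro i
    rw [intervalIntegral.integral_of_le zero_le_one]
    rw [MeasureTheory.integral_indicator measurableSet_Iio,
      MeasureTheory.Measure.restrict_restrict measurableSet_Iio, MeasureTheory.setIntegral_const]
    congr 1
    rw [show Set.Iio (b i) ∩ Set.Ioc 0 1 = Set.Ioo 0 (b i) from ?_]
    · simp [MeasureTheory.measureReal_def, hb0 i]
    · ext t
      constructor
      · rintro ⟨h1, h2⟩
        exact ⟨h2.1, h1⟩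
      · rintro ⟨h1, h2⟩
        exact ⟨h2, h1, h2.le.trans (hb1 i)⟩
  have hint : ∀ i, IntervalIntegrable (fun t => (Set.Iio (b i)).indicator (fun _ => d i) t)
      MeasureTheory.volume 0 1 := by
    intro i
    rw [intervalIntegrable_iff_integrableOn_Ioc_of_le zero_le_one]
    exact ((MeasureTheory.integrable_const (d i)).indicator measurableSet_Iio)
  have hsum : ∑ i, b i • d i =
      ∫ t in (0 : ℝ)..1, ∑ i, (Set.Iio (b i)).indicator (fun _ => d i) t := by
    rw [intervalIntegral.integral_finsetSum fun i _ => hint i]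
    exact Finset.sum_congr rfl fun i _ => hcoef i
  have hexp : -1 < -(q / s) := by
    have : q / s < 1 := (div_lt_one hs).2 hqs
    linarith
  have hbound : ∀ t ∈ Set.Ioc (0 : ℝ) 1, ‖∑ i, (Set.Iio (b i)).indicator (fun _ => d i) t‖ ≤
      K * S ^ (1 / s) * t ^ (-(q / s)) := by
    intro t ht
    have h1 : ∑ i, (Set.Iio (b i)).indicator (fun _ => d i) t = ∑ i with t < b i, d i := by
      rw [Finset.sum_filter]
      exact Finset.sum_congr rfl fun i _ => by simp [Set.indicator_apply]
    rw [h1]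
    refine (hd _).trans ?_
    rw [mul_assoc]
    refine mul_le_mul_of_nonneg_left ?_ hK
    have h2 : ((Finset.univ.filter fun i => t < b i).card : ℝ) * t ^ q ≤ S := by
      refine le_trans ?_ hS
      rw [← nsmul_eq_mul]
      refine (Finset.card_nsmul_le_sum _ _ _ fun i hi => ?_).trans
        (Finset.sum_le_sum_of_subset_of_nonneg (Finset.filter_subset _ _)
          fun i _ _ => Real.rpow_nonneg (hb0 i) q)
      exact Real.rpow_le_rpow ht.1.le (Finset.mem_filter.1 hi).2.le hq.le
    have h3 : ((Finset.univ.filter fun i => t < b i).card : ℝ) ≤ S * t ^ (-q) := by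
      rw [Real.rpow_neg ht.1.le, ← div_eq_mul_inv]
      exact (le_div_iff₀ (Real.rpow_pos_of_pos ht.1 q)).2 h2
    refine (Real.rpow_le_rpow (Nat.cast_nonneg _) h3 (by positivity)).trans (le_of_eq ?_)
    rw [Real.mul_rpow hS0 (Real.rpow_nonneg ht.1.le _), ← Real.rpow_mul ht.1.le]
    congr 2
    ring
  rw [hsum]
  refine (intervalIntegral.norm_integral_le_of_norm_le zero_le_one
    (Filter.Eventually.of_forall hbound)
    ((intervalIntegral.intervalIntegrable_rpow' hexp).const_mul _)).trans (le_of_eq ?_)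
  rw [intervalIntegral.integral_const_mul, integral_rpow (Or.inl hexp), Real.one_rpow,
    Real.zero_rpow (by linarith)]
  ring

lemma hasUpperFamilies_of_not_hasCotype [CompleteSpace Y] {q s : ℝ} (hq : 0 < q)
    (hqs : q < s) (hs : 2 < s) (h : ¬HasCotype Y s) : HasUpperFamilies 𝕂 Y q := by
  let _ : NormedSpace ℝ Y := NormedSpace.restrictScalars ℝ 𝕂 Y
  have hsmul : ∀ (r : ℝ) (v : Y), (r : 𝕂) • v = r • v := fun r v => by
    rw [← algebraMap_smul 𝕂 r v]
  have hqs1 : q / s < 1 := (div_lt_one (hq.trans hqs)).2 hqs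
  refine ⟨s, 8 * (16 / (1 - q / s)), hqs,
    mul_nonneg (by norm_num) (div_nonneg (by norm_num) (by linarith)), fun n => ?_⟩
  obtain ⟨d, hd1, hd⟩ := exists_upper_estimate_subset_sums hs h n
  refine ⟨fun j => (2 : ℝ) • d j, fun j => ?_, fun b S hb hS => ?_⟩
  · rw [norm_smul, Real.norm_ofNat]
    linarith [hd1 j]
  have key : ∀ c : Fin n → ℝ, (∀ j, |c j| ≤ ‖b j‖) →
      ‖∑ j, (c j : 𝕂) • d j‖ ≤ 2 * (16 / (1 - q / s) * S ^ (1 / s)) := by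
    have pos : ∀ c : Fin n → ℝ, (∀ j, 0 ≤ c j) → (∀ j, c j ≤ ‖b j‖) →
        ‖∑ j, c j • d j‖ ≤ 16 / (1 - q / s) * S ^ (1 / s) := fun c hc0 hc =>
      norm_sum_smul_le_of_subset_sums hq hqs (by norm_num) d hd c hc0
        (fun j => (hc j).trans (hb j))
        ((Finset.sum_le_sum fun j _ => Real.rpow_le_rpow (hc0 j) (hc j) hq.le).trans hS)
    intro c hc
    have h1 : ∑ j, (c j : 𝕂) • d j = ∑ j, max (c j) 0 • d j - ∑ j, max (-c j) 0 • d j := by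
      rw [← Finset.sum_sub_distrib]
      refine Finset.sum_congr rfl fun j _ => ?_
      rw [← sub_smul, hsmul, max_zero_sub_eq_self]
    rw [h1]
    refine (norm_sub_le _ _).trans ?_
    have h2 := pos (fun j => max (c j) 0) (fun j => le_max_right _ _) fun j =>
      max_le ((le_abs_self _).trans (hc j)) (norm_nonneg _)
    have h3 := pos (fun j => max (-c j) 0) (fun j => le_max_right _ _) fun j =>
      max_le ((neg_le_abs _).trans (hc j)) (norm_nonneg _)
    linarith
  have hre := key (fun j => RCLike.re (b j)) fun j => RCLike.abs_re_le_norm _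
  have him := key (fun j => RCLike.im (b j)) fun j => RCLike.abs_im_le_norm _
  have hsplit : ∑ j, b j • (2 : ℝ) • d j = (2 : 𝕂) • (∑ j, ((RCLike.re (b j) : ℝ) : 𝕂) • d j +
      (RCLike.I : 𝕂) • ∑ j, ((RCLike.im (b j) : ℝ) : 𝕂) • d j) := by
    rw [Finset.smul_sum, ← Finset.sum_add_distrib, Finset.smul_sum]
    refine Finset.sum_congr rfl fun j _ => ?_
    rw [← hsmul, smul_smul, smul_smul, ← add_smul, smul_smul]
    congr 1
    conv_lhs => rw [← RCLike.re_add_im (b j)]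
    push_cast
    ring
  rw [hsplit, norm_smul, RCLike.norm_ofNat]
  have h4 : ‖(RCLike.I : 𝕂) • ∑ j, ((RCLike.im (b j) : ℝ) : 𝕂) • d j‖ ≤
      ‖∑ j, ((RCLike.im (b j) : ℝ) : 𝕂) • d j‖ := by
    rw [norm_smul]
    refine mul_le_of_le_one_left (norm_nonneg _) ?_
    rcases RCLike.I_eq_zero_or_im_I_eq_one (K := 𝕂) with h | h
    · simp [h]
    · exact (RCLike.norm_I_of_ne_zero (fun h0 => by simp [h0] at h)).le
  have h5 := norm_add_le (∑ j, ((RCLike.re (b j) : ℝ) : 𝕂) • d j)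
    ((RCLike.I : 𝕂) • ∑ j, ((RCLike.im (b j) : ℝ) : 𝕂) • d j)
  linarith

end UpperFamilies

section DvoretzkyRogers

variable {𝕂 : Type*} [RCLike 𝕂]

/-- A linear map acting as the identity on `K` and as the scalar `μ` on `Kᗮ` has determinant
`μ ^ dim Kᗮ`. -/
lemma det_eq_pow_finrank_orthogonal {V : Type*} [NormedAddCommGroup V] [InnerProductSpace 𝕂 V]
    [FiniteDimensional 𝕂 V] (K : Submodule 𝕂 V) (A : V →ₗ[𝕂] V) (μ : 𝕂)
    (hK : ∀ x ∈ K, A x = x) (hK' : ∀ x ∈ Kᗮ, A x = μ • x) :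
    LinearMap.det A = μ ^ Module.finrank 𝕂 Kᗮ := by
  let e := K.prodEquivOfIsCompl _ K.isCompl_orthogonal
  let b := (Module.finBasis 𝕂 K).prod (Module.finBasis 𝕂 Kᗮ)
  have h1 : ∀ x : K, A x = x := fun x => hK _ x.2
  have h2 : ∀ x : Kᗮ, A x = μ • x := fun x => hK' _ x.2
  have : LinearMap.toMatrix b b (e.symm ∘ₗ A ∘ₗ e.symm.symm) =
      Matrix.fromBlocks 1 0 0 (μ • 1) := by
    ext (_ | _) (_ | _) <;>
    simp [LinearMap.toMatrix_apply, b, Matrix.one_apply, Finsupp.single_apply, e, eq_comm, h1, h2]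
  rw [← LinearMap.det_conj _ e.symm, ← LinearMap.det_toMatrix b, this, Matrix.det_fromBlocks_zero₂₁,
    Matrix.det_one, one_mul, Matrix.det_smul, Fintype.card_fin, Matrix.det_one, mul_one]

lemma one_add_half_inv_pow_lt {n : ℕ} (hn : 0 < n) :
    (1 + (n : ℝ)⁻¹ / 2) ^ (2 * n) < (1 + (n : ℝ)⁻¹) ^ (n + 1) := by
  have hn' : (0 : ℝ) < (n : ℝ)⁻¹ := by positivity
  set ε := (n : ℝ)⁻¹ with hε
  have hnε : (n : ℝ) * ε = 1 := mul_inv_cancel₀ (by positivity)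
  have hε1 : ε ≤ 1 := by
    rw [hε]
    exact inv_le_one_of_one_le₀ (by exact_mod_cast hn)
  have h1 : (1 + ε / 2) ^ 2 ≤ (1 + ε) * Real.exp (ε ^ 2 / 4) := by
    have := Real.add_one_le_exp (ε ^ 2 / 4)
    nlinarith [sq_nonneg ε]
  have h2 : (1 + ε / 2) ^ (2 * n) ≤ (1 + ε) ^ n * Real.exp (ε / 4) := by
    rw [pow_mul]
    refine (pow_le_pow_left₀ (by positivity) h1 n).trans (le_of_eq ?_)
    rw [mul_pow, ← Real.exp_nat_mul]
    congr 2
    linear_combination ε / 4 * hnε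
  refine h2.trans_lt ?_
  rw [pow_succ]
  refine mul_lt_mul_of_pos_left ?_ (by positivity)
  have h3 := Real.one_sub_le_exp_neg (ε / 4)
  have h4 : Real.exp (ε / 4) * Real.exp (-(ε / 4)) = 1 := by rw [← Real.exp_add]; simp
  have h5 := Real.exp_pos (ε / 4)
  by_contra! h6
  nlinarith [mul_le_mul_of_nonneg_left h3 h5.le,
    mul_le_mul_of_nonneg_right h6 (show 0 ≤ 1 - ε / 4 by linarith)]

/-- An operator of norm at most one and of maximal determinant is bounded below by `1 / 2` at some
unit vector orthogonal to a given subspace of at most half dimension. -/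
lemma exists_orthogonal_unit_of_isMax_det {V E : Type*} [NormedAddCommGroup V]
    [InnerProductSpace 𝕂 V] [FiniteDimensional 𝕂 V] [NormedAddCommGroup E] [NormedSpace 𝕂 E]
    {n : ℕ} (hn : 0 < n) (hV : Module.finrank 𝕂 V = 2 * n) (φ : E →L[𝕂] V) (u : V →L[𝕂] E)
    (hu : ‖u‖ ≤ 1) (hdet : (φ.comp u).det ≠ 0)
    (hmax : ∀ v : V →L[𝕂] E, ‖v‖ ≤ 1 → ‖(φ.comp v).det‖ ≤ ‖(φ.comp u).det‖)
    (K : Submodule 𝕂 V) (hK : Module.finrank 𝕂 K < n) : ∃ g ∈ Kᗮ, ‖g‖ = 1 ∧ 1 / 2 ≤ ‖u g‖ := by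
  by_contra! h
  have hsmall : ∀ g ∈ Kᗮ, ‖u g‖ ≤ 1 / 2 * ‖g‖ := by
    intro g hg
    rcases eq_or_ne g 0 with rfl | hg0
    · simp
    have hpos := norm_pos_iff.2 hg0
    have h1 := h (((‖g‖⁻¹ : ℝ) : 𝕂) • g) (Kᗮ.smul_mem _ hg) (by
      rw [norm_smul, RCLike.norm_ofReal, abs_of_nonneg (by positivity), inv_mul_cancel₀ hpos.ne'])
    rw [map_smul, norm_smul, RCLike.norm_ofReal, abs_of_nonneg (by positivity),
      inv_mul_lt_iff₀ hpos] at h1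
    linarith
  set ε : ℝ := (n : ℝ)⁻¹ with hε
  have hε0 : 0 < ε := by positivity
  set A : V →L[𝕂] V := ContinuousLinearMap.id 𝕂 V + (ε : 𝕂) • Kᗮ.starProjection with hA
  have hAnorm : ‖u.comp A‖ ≤ 1 + ε / 2 := by
    refine ContinuousLinearMap.opNorm_le_bound _ (by positivity) fun x => ?_
    have h1 : (u.comp A) x = u x + (ε : 𝕂) • u (Kᗮ.starProjection x) := by simp [hA]
    rw [h1]
    refine (norm_add_le _ _).trans ?_
    rw [norm_smul, RCLike.norm_ofReal, abs_of_pos hε0]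
    have h2 := hsmall _ (Kᗮ.starProjection_apply_mem x)
    have h3 := Kᗮ.norm_starProjection_apply_le x
    have h4 := u.le_of_opNorm_le hu x
    nlinarith
  have hAdet : A.det = (1 + (ε : 𝕂)) ^ Module.finrank 𝕂 Kᗮ := by
    refine det_eq_pow_finrank_orthogonal K A.toLinearMap _ (fun x hx => ?_) fun x hx => ?_
    · have : Kᗮ.starProjection x = 0 := by
        rw [Submodule.starProjection_apply_eq_zero_iff]
        exact K.le_orthogonal_orthogonal hx
      simp [hA, this]
    · simp [hA, Submodule.starProjection_eq_self_iff.2 hx, add_smul]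
  set r : ℝ := (1 + ε / 2)⁻¹ with hr
  have hr0 : 0 < r := by positivity
  have h1 := hmax ((r : 𝕂) • u.comp A) (by
    rw [norm_smul, RCLike.norm_ofReal, abs_of_pos hr0, hr, inv_mul_le_iff₀ (by positivity), mul_one]
    exact hAnorm)
  have h2 : (φ.comp ((r : 𝕂) • u.comp A)).det = (r : 𝕂) ^ (2 * n) * ((φ.comp u).det * A.det) := by
    rw [← hV]
    have : (φ.comp ((r : 𝕂) • u.comp A)) = (r : 𝕂) • ((φ.comp u).comp A) := by
      ext x
      simp
    rw [this]
    simp only [ContinuousLinearMap.det]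
    rw [ContinuousLinearMap.toLinearMap_smul, LinearMap.det_smul,
      ContinuousLinearMap.toLinearMap_comp, LinearMap.det_comp]
  have h3 : ‖1 + (ε : 𝕂)‖ = 1 + ε := by
    rw [← RCLike.ofReal_one, ← RCLike.ofReal_add, RCLike.norm_ofReal, abs_of_pos (by positivity)]
  rw [h2, hAdet, norm_mul, norm_mul, norm_pow, norm_pow, RCLike.norm_ofReal, abs_of_pos hr0, h3,
    hr, inv_pow, inv_mul_le_iff₀ (by positivity)] at h1
  have h4 : (1 + ε) ^ (n + 1) ≤ (1 + ε) ^ Module.finrank 𝕂 Kᗮ := by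
    refine pow_le_pow_right₀ (by linarith) ?_
    have := K.finrank_add_finrank_orthogonal
    omega
  have h5 := one_add_half_inv_pow_lt hn
  have h6 : 0 < ‖(φ.comp u).det‖ := norm_pos_iff.2 hdet
  nlinarith

/-- A finite-dimensional form of the Dvoretzky–Rogers lemma. -/
lemma exists_upper_two_estimate {Y : Type*} [NormedAddCommGroup Y] [NormedSpace 𝕂 Y]
    (hY : ¬FiniteDimensional 𝕂 Y) (n : ℕ) :
    ∃ y : Fin n → Y, (∀ j, 1 ≤ ‖y j‖) ∧
      ∀ b : Fin n → 𝕂, ‖∑ j, b j • y j‖ ≤ 2 * Real.sqrt (∑ j, ‖b j‖ ^ 2) := by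
  rcases Nat.eq_zero_or_pos n with rfl | hn
  · exact ⟨Fin.elim0, fun j => j.elim0, fun b => by simp⟩
  obtain ⟨w, hw⟩ := exists_linearIndependent_of_le_rank (R := 𝕂) (M := Y) (n := 2 * n)
    (le_trans (Cardinal.natCast_lt_aleph0).le (not_lt.1 (mt Module.rank_lt_aleph0_iff.1 hY)))
  set E : Submodule 𝕂 Y := Submodule.span 𝕂 (Set.range w)
  have hE : Module.finrank 𝕂 E = 2 * n := by
    rw [finrank_span_eq_card hw, Fintype.card_fin]
  have hEfin : FiniteDimensional 𝕂 E := FiniteDimensional.span_of_finite 𝕂 (Set.finite_range w)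
  let V := EuclideanSpace 𝕂 (Fin (2 * n))
  have hV : Module.finrank 𝕂 V = 2 * n := by simp [V]
  let φ : E ≃L[𝕂] V := ContinuousLinearEquiv.ofFinrankEq (hE.trans hV.symm)
  have hproper : ProperSpace (V →L[𝕂] E) := FiniteDimensional.proper_rclike 𝕂 _
  have hcont : Continuous fun v : V →L[𝕂] E => ‖((φ : E →L[𝕂] V).comp v).det‖ :=
    (ContinuousLinearMap.continuous_det.comp
      ((ContinuousLinearMap.compL 𝕂 V E V (φ : E →L[𝕂] V)).continuous)).norm
  obtain ⟨u, hu, hmax⟩ := (isCompact_closedBall (0 : V →L[𝕂] E) 1).exists_isMaxOn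
    ⟨0, by simp⟩ hcont.continuousOn
  rw [mem_closedBall_zero_iff] at hu
  replace hmax : ∀ v : V →L[𝕂] E, ‖v‖ ≤ 1 → ‖((φ : E →L[𝕂] V).comp v).det‖ ≤
      ‖((φ : E →L[𝕂] V).comp u).det‖ := fun v hv => hmax (mem_closedBall_zero_iff.2 hv)
  have hdet : ((φ : E →L[𝕂] V).comp u).det ≠ 0 := by
    set v : V →L[𝕂] E := (φ.symm : V →L[𝕂] E)
    set r : ℝ := (1 + ‖v‖)⁻¹ with hr
    have hr0 : 0 < r := by positivity
    have h1 := hmax ((r : 𝕂) • v) (by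
      rw [norm_smul, RCLike.norm_ofReal, abs_of_pos hr0, hr, inv_mul_le_iff₀ (by positivity)]
      linarith)
    have h2 : ((φ : E →L[𝕂] V).comp ((r : 𝕂) • v)).det = (r : 𝕂) ^ (2 * n) := by
      have : (φ : E →L[𝕂] V).comp ((r : 𝕂) • v) = (r : 𝕂) • ContinuousLinearMap.id 𝕂 V := by
        ext1 x
        simp [v]
      rw [this]
      change LinearMap.det ((r : 𝕂) • (LinearMap.id : V →ₗ[𝕂] V)) = _
      rw [LinearMap.det_smul, hV, LinearMap.det_id, mul_one]
    rw [← norm_pos_iff]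
    refine lt_of_lt_of_le ?_ h1
    rw [h2, norm_pos_iff]
    exact pow_ne_zero _ (RCLike.ofReal_ne_zero.2 hr0.ne')
  have hgreedy : ∀ k ≤ n, ∃ f : Fin k → V, Orthonormal 𝕂 f ∧ ∀ i, 1 / 2 ≤ ‖u (f i)‖ := by
    intro k
    induction k with
    | zero => exact fun _ => ⟨Fin.elim0, ⟨fun i => i.elim0, fun i => i.elim0⟩, fun i => i.elim0⟩
    | succ k ih =>
      intro hk
      obtain ⟨f, hf, hfu⟩ := ih (by omega)
      obtain ⟨g, hgK, hg1, hgu⟩ := exists_orthogonal_unit_of_isMax_det hn hV (φ : E →L[𝕂] V) u hu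
        hdet hmax (Submodule.span 𝕂 (Set.range f)) (by
          rw [finrank_span_eq_card hf.linearIndependent, Fintype.card_fin]
          omega)
      have hgf : ∀ i, inner 𝕂 (f i) g = 0 := fun i =>
        (Submodule.mem_orthogonal _ _).1 hgK _ (Submodule.subset_span ⟨i, rfl⟩)
      have hfg : ∀ i, inner 𝕂 g (f i) = 0 := fun i => inner_eq_zero_symm.1 (hgf i)
      refine ⟨Fin.cons g f, ⟨?_, ?_⟩, ?_⟩
      · intro i
        refine Fin.cases ?_ (fun i => ?_) i
        · simpa using hg1
        · simpa using hf.1 i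
      · intro i j
        refine Fin.cases ?_ (fun i => ?_) i <;> refine Fin.cases ?_ (fun j => ?_) j
        · simp
        · simpa using fun _ => hfg j
        · simpa using hgf i
        · simpa using fun h => hf.2 h
      · intro i
        refine Fin.cases ?_ (fun i => ?_) i
        · simpa using hgu
        · simpa using hfu i
  obtain ⟨f, hf, hfu⟩ := hgreedy n le_rfl
  refine ⟨fun j => (2 : 𝕂) • (u (f j) : Y), fun j => ?_, fun b => ?_⟩
  · rw [norm_smul, RCLike.norm_ofNat]
    change 1 ≤ 2 * ‖u (f j)‖
    linarith [hfu j]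
  · have h1 : ∑ j, b j • (2 : 𝕂) • (u (f j) : Y) = (2 : 𝕂) • (u (∑ j, b j • f j) : Y) := by
      rw [map_sum, Submodule.coe_sum, Finset.smul_sum]
      refine Finset.sum_congr rfl fun j _ => ?_
      rw [map_smul, Submodule.coe_smul, smul_comm]
    have h2 : ‖∑ j, b j • f j‖ = Real.sqrt (∑ j, ‖b j‖ ^ 2) := by
      rw [← Real.sqrt_sq (norm_nonneg (∑ j, b j • f j)), ← inner_self_eq_norm_sq (𝕜 := 𝕂),
        hf.inner_sum, map_sum]
      congr 1
      refine Finset.sum_congr rfl fun j _ => ?_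
      rw [RCLike.conj_mul, ← RCLike.ofReal_pow, RCLike.ofReal_re]
    rw [h1, norm_smul, RCLike.norm_ofNat, ← h2]
    change 2 * ‖u (∑ j, b j • f j)‖ ≤ _
    have := u.le_of_opNorm_le hu (∑ j, b j • f j)
    linarith

lemma hasUpperFamilies_of_lt_two {Y : Type*} [NormedAddCommGroup Y] [NormedSpace 𝕂 Y]
    (hY : ¬FiniteDimensional 𝕂 Y) {q : ℝ} (hq : 0 < q) (hq2 : q < 2) :
    HasUpperFamilies 𝕂 Y q := by
  refine ⟨2, 2, hq2, zero_le_two, fun n => ?_⟩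
  obtain ⟨y, hy, hyb⟩ := exists_upper_two_estimate hY n
  refine ⟨y, hy, fun b S hb hS => (hyb b).trans ?_⟩
  rw [← Real.sqrt_eq_rpow]
  refine mul_le_mul_of_nonneg_left (Real.sqrt_le_sqrt (le_trans ?_ hS)) zero_le_two
  refine Finset.sum_le_sum fun j _ => ?_
  rw [← Real.rpow_natCast]
  exact Real.rpow_le_rpow_of_exponent_ge' (norm_nonneg (b j)) (hb j) hq.le
    (by exact_mod_cast hq2.le)

end DvoretzkyRogers

section Coordinates

variable {𝕂 : Type*} [RCLike 𝕂] {X : Type*} [NormedAddCommGroup X] [NormedSpace 𝕂 X] {e : ℕ → X}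

/-- A normalized unconditional basis has uniformly bounded coordinate functionals and uniformly
bounded restrictions to finite sets. -/
lemma IsNormalizedUncondBasis.exists_coord (he : IsNormalizedUncondBasis 𝕂 X e) :
    ∃ (g : ℕ → X →L[𝕂] 𝕂) (R : ℝ), 0 < R ∧
      (∀ (x : X) (a : ℕ → 𝕂), HasSum (fun n => a n • e n) x → ∀ n, a n = g n x) ∧
      (∀ x, HasSum (fun n => g n x • e n) x) ∧
      (∀ n x, ‖g n x‖ ≤ R * ‖x‖) ∧
      ∀ (F : Finset ℕ) (x : X), ‖∑ j ∈ F, g j x • e j‖ ≤ R * ‖x‖ := by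
  classical
  obtain ⟨he1, hex, ρ, hρ, hsign⟩ := he
  choose c hc hcu using hex
  replace hcu : ∀ (x : X) (a : ℕ → 𝕂), HasSum (fun n => a n • e n) x → ∀ n, a n = c x n :=
    fun x a ha n => congrFun (hcu x a ha) n
  have hF : ∀ (F : Finset ℕ) (x : X), ‖∑ j ∈ F, c x j • e j‖ ≤ (1 + ρ) / 2 * ‖x‖ := by
    intro F x
    have h1 : HasSum (fun n => if n ∈ F then (2 : 𝕂) • c x n • e n else 0)
        ((2 : 𝕂) • ∑ j ∈ F, c x j • e j) := by
      rw [Finset.smul_sum, ← Finset.sum_congr rfl fun j hj => if_pos hj]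
      exact hasSum_sum_of_ne_finset_zero fun j hj => if_neg hj
    have h2 := hsign (c x) (fun n => if n ∈ F then -1 else 1) x (x - (2 : 𝕂) • ∑ j ∈ F, c x j • e j)
      (fun n => by by_cases hn : n ∈ F <;> simp [hn]) (hc x) (by
        convert (hc x).sub h1 using 2 with n
        by_cases hn : n ∈ F
        · simp only [hn, if_true, neg_mul, one_mul, neg_smul, two_smul]
          abel
        · simp [hn])
    have h3 := norm_sub_le x (x - (2 : 𝕂) • ∑ j ∈ F, c x j • e j)
    rw [sub_sub_cancel, norm_smul, RCLike.norm_ofNat] at h3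
    linarith
  have hb : ∀ n x, ‖c x n‖ ≤ (1 + ρ) / 2 * ‖x‖ := fun n x => by
    simpa [norm_smul, he1] using hF {n} x
  have hadd : ∀ n x y, c (x + y) n = c x n + c y n := fun n x y => by
    refine (hcu _ (fun n => c x n + c y n) ?_ n).symm
    simpa only [add_smul] using (hc x).add (hc y)
  have hsmul : ∀ n (r : 𝕂) x, c (r • x) n = r * c x n := fun n r x => by
    refine (hcu _ (fun n => r * c x n) ?_ n).symm
    simpa only [mul_smul] using (hc x).const_smul r
  let g : ℕ → X →L[𝕂] 𝕂 := fun n => LinearMap.mkContinuous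
    { toFun := fun x => c x n
      map_add' := hadd n
      map_smul' := hsmul n } ((1 + ρ) / 2) (hb n)
  have hg : ∀ n x, g n x = c x n := fun n x => rfl
  refine ⟨g, (1 + ρ) / 2, by linarith, ?_⟩
  simp only [hg]
  exact ⟨hcu, hc, hb, hF⟩

/-- The coordinatewise parts of a convergent series are weakly summable. -/
lemma weaklySummable_of_hasSum {z : ℕ → X} {x : X} (h : HasSum z x) : WeaklySummable 𝕂 z :=
  fun φ => (h.mapL φ).summable.norm

end Coordinates

section Blocks

/-- A divergent series of nonnegative terms has disjoint finite blocks with prescribed large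
sums. -/
lemma exists_disjoint_blocks {f : ℕ → ℝ} (hf0 : ∀ n, 0 ≤ f n) (hf : ¬Summable f) (M : ℕ → ℝ) :
    ∃ F : ℕ → Finset ℕ, (∀ k l, k ≠ l → Disjoint (F k) (F l)) ∧ ∀ k, M k ≤ ∑ j ∈ F k, f j := by
  have h : ∀ k N : ℕ, ∃ N' : ℕ, N ≤ N' ∧ M k ≤ ∑ j ∈ Finset.Ico N N', f j := by
    intro k N
    have h1 := (not_summable_iff_tendsto_nat_atTop_of_nonneg hf0).1 hf
    obtain ⟨N', hN', h2⟩ := ((Filter.eventually_ge_atTop N).and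
      (h1.eventually_ge_atTop (M k + ∑ j ∈ Finset.range N, f j))).exists
    refine ⟨N', hN', ?_⟩
    rw [Finset.sum_Ico_eq_sub _ hN']
    linarith
  choose next hle hM using h
  let N : ℕ → ℕ := fun k => Nat.rec 0 (fun k N => next k N) k
  have hmono : Monotone N := monotone_nat_of_le_succ fun k => hle k (N k)
  refine ⟨fun k => Finset.Ico (N k) (N (k + 1)), fun k l hkl => ?_, fun k => hM k (N k)⟩
  rw [Finset.disjoint_left]
  intro j hj hj'
  rw [Finset.mem_Ico] at hj hj'
  rcases lt_or_gt_of_ne hkl with h | h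
  · have := hmono (Nat.succ_le_of_lt h)
    simp only [Nat.succ_eq_add_one] at this
    omega
  · have := hmono (Nat.succ_le_of_lt h)
    simp only [Nat.succ_eq_add_one] at this
    omega

lemma not_summable_of_disjoint_blocks {f : ℕ → ℝ} (hf0 : ∀ n, 0 ≤ f n) {F : ℕ → Finset ℕ}
    (hF : ∀ k l, k ≠ l → Disjoint (F k) (F l)) (h : ∀ k, 1 ≤ ∑ j ∈ F k, f j) : ¬Summable f := by
  intro hf
  obtain ⟨n, hn⟩ := exists_nat_gt (∑' j, f j)
  have h1 : (n : ℝ) ≤ ∑ k ∈ Finset.range n, ∑ j ∈ F k, f j := by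
    simpa using Finset.card_nsmul_le_sum (Finset.range n) (fun k => ∑ j ∈ F k, f j) 1 fun k _ => h k
  rw [← Finset.sum_biUnion fun k _ l _ hkl => hF k l hkl] at h1
  linarith [hf.sum_le_tsum ((Finset.range n).biUnion F) fun j _ => hf0 j]

lemma prod_rpow_le_sum_rpow {m : ℕ} (hm : 0 < m) {q : ℝ} (hq : 0 < q) (c : Fin m → ℝ)
    (hc : ∀ i, 0 ≤ c i) : (∏ i, c i) ^ q ≤ ∑ i, c i ^ ((m : ℝ) * q) := by
  have : Nonempty (Fin m) := ⟨⟨0, hm⟩⟩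
  obtain ⟨i, -, hi⟩ := Finset.exists_max_image Finset.univ c Finset.univ_nonempty
  have h1 : ∏ i, c i ≤ c i ^ m := by
    refine (Finset.prod_le_prod (fun j _ => hc j) fun j _ => hi j (Finset.mem_univ j)).trans
      (le_of_eq ?_)
    simp
  refine (Real.rpow_le_rpow (Finset.prod_nonneg fun j _ => hc j) h1 hq.le).trans ?_
  rw [← Real.rpow_natCast, ← Real.rpow_mul (hc i)]
  exact Finset.single_le_sum (f := fun i => c i ^ ((m : ℝ) * q))
    (fun j _ => Real.rpow_nonneg (hc j) _) (Finset.mem_univ i)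

lemma exists_forall_ge_one_le_rpow {A c q s : ℝ} (hA : 0 < A) (hc : 0 < c) (hq : 0 < q)
    (hqs : q < s) : ∃ M, 0 < M ∧ ∀ S, M ≤ S → 1 ≤ (A / (c * S) ^ (1 / s)) ^ q * (S / 2) := by
  have hs : 0 < s := hq.trans hqs
  have hexp : 0 < 1 - q / s := by
    have : q / s < 1 := (div_lt_one hs).2 hqs
    linarith
  obtain ⟨M, hM⟩ := Filter.eventually_atTop.1
    ((tendsto_rpow_atTop hexp).eventually_ge_atTop (2 * (c ^ (q / s) / A ^ q)))
  refine ⟨max M 1, by positivity, fun S hS => ?_⟩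
  have hS0 : 0 < S := lt_of_lt_of_le (by positivity) hS
  have h1 := hM S ((le_max_left _ _).trans hS)
  have hSq : 0 < S ^ (q / s) := Real.rpow_pos_of_pos hS0 _
  have hcq : 0 < c ^ (q / s) := Real.rpow_pos_of_pos hc _
  have hAq : 0 < A ^ q := Real.rpow_pos_of_pos hA _
  rw [Real.rpow_sub hS0, Real.rpow_one] at h1
  rw [Real.div_rpow hA.le (by positivity), ← Real.rpow_mul (by positivity),
    show 1 / s * q = q / s by ring, Real.mul_rpow hc.le hS0.le]
  rw [le_div_iff₀ hSq] at h1
  rw [div_mul_div_comm, le_div_iff₀ (by positivity)]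
  have h2 := mul_le_mul_of_nonneg_left h1 hAq.le
  have h3 : A ^ q * (2 * (c ^ (q / s) / A ^ q) * S ^ (q / s)) =
      c ^ (q / s) * S ^ (q / s) * 2 := by
    field_simp
  linarith

end Blocks

section DiagonalForms

variable {𝕂 : Type*} [RCLike 𝕂] {X Y : Type*} [NormedAddCommGroup X] [NormedSpace 𝕂 X]
  [NormedAddCommGroup Y] [NormedSpace 𝕂 Y]

lemma Finset.sum_equivFin_symm {α G : Type*} [AddCommMonoid G] (F : Finset α)
    (f : α → Fin F.card → G) :
    ∑ i, f (F.equivFin.symm i) i = ∑ j ∈ F.attach, f j (F.equivFin j) := by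
  rw [← Finset.univ_eq_attach]
  exact Fintype.sum_equiv F.equivFin.symm _ _ fun j => by simp

lemma HasUpperFamilies.exists_on_finset {q : ℝ} (h : HasUpperFamilies 𝕂 Y q) :
    ∃ s C : ℝ, q < s ∧ 0 < C ∧ ∀ F : Finset ℕ, ∃ y : ℕ → Y, (∀ j ∈ F, 1 ≤ ‖y j‖) ∧
      ∀ (b : ℕ → 𝕂) (S : ℝ), (∀ j, ‖b j‖ ≤ 1) → ∑ j ∈ F, ‖b j‖ ^ q ≤ S →
        ‖∑ j ∈ F, b j • y j‖ ≤ C * S ^ (1 / s) := by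
  classical
  obtain ⟨s, C, hqs, hC, h⟩ := h
  refine ⟨s, C + 1, hqs, by linarith, fun F => ?_⟩
  obtain ⟨y, hy, hyb⟩ := h F.card
  refine ⟨fun j => if hj : j ∈ F then y (F.equivFin ⟨j, hj⟩) else 0,
    fun j hj => ?_, fun b S hb hS => ?_⟩
  · simpa [hj] using hy _
  · have hS0 : 0 ≤ S :=
      (Finset.sum_nonneg fun j _ => Real.rpow_nonneg (norm_nonneg (b j)) q).trans hS
    have h1 := hyb (fun j => b (F.equivFin.symm j)) S (fun j => hb _) (by
      rw [F.sum_equivFin_symm fun j _ => ‖b j‖ ^ q, Finset.sum_attach F fun j => ‖b j‖ ^ q]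
      exact hS)
    rw [F.sum_equivFin_symm fun j i => b j • y i] at h1
    rw [← Finset.sum_attach F]
    simp only [Finset.coe_mem, dite_true, Subtype.coe_eta]
    exact h1.trans (mul_le_mul_of_nonneg_right (by linarith) (Real.rpow_nonneg hS0 _))

/-- The `m`-linear map `(v₁, …, vₘ) ↦ ∑ j ∈ F, h j v₁ ⋯ h j vₘ • y j`. -/
noncomputable def diagonalForm (m : ℕ) (h : ℕ → X →L[𝕂] 𝕂) (F : Finset ℕ) (y : ℕ → Y) :
    ContinuousMultilinearMap 𝕂 (fun _ : Fin m => X) Y :=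
  ∑ j ∈ F, ((ContinuousMultilinearMap.mkPiAlgebra 𝕂 (Fin m) 𝕂).compContinuousLinearMap
    fun _ => h j).smulRight (y j)

lemma diagonalForm_apply (m : ℕ) (h : ℕ → X →L[𝕂] 𝕂) (F : Finset ℕ) (y : ℕ → Y)
    (v : Fin m → X) : diagonalForm m h F y v = ∑ j ∈ F, (∏ i, h j (v i)) • y j := by
  simp [diagonalForm]

lemma ContinuousMultilinearMap.opNorm_le_of_forall_norm_le_one {m : ℕ}
    (T : ContinuousMultilinearMap 𝕂 (fun _ : Fin m => X) Y) {K : ℝ} (hK : 0 ≤ K)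
    (h : ∀ v : Fin m → X, (∀ i, ‖v i‖ ≤ 1) → ‖T v‖ ≤ K) : ‖T‖ ≤ K := by
  refine T.opNorm_le_bound hK fun v => ?_
  by_cases hv : ∃ i, v i = 0
  · obtain ⟨i, hi⟩ := hv
    rw [T.map_coord_zero i hi, norm_zero]
    exact mul_nonneg hK (Finset.prod_nonneg fun i _ => norm_nonneg _)
  · push Not at hv
    have h1 : v = fun i => (‖v i‖ : 𝕂) • (((‖v i‖⁻¹ : ℝ) : 𝕂) • v i) := by
      funext i
      rw [smul_smul, ← RCLike.ofReal_mul, mul_inv_cancel₀ (norm_ne_zero_iff.2 (hv i)),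
        RCLike.ofReal_one, one_smul]
    have h2 := h (fun i => ((‖v i‖⁻¹ : ℝ) : 𝕂) • v i) fun i => by
      rw [norm_smul, RCLike.norm_ofReal, abs_of_nonneg (by positivity),
        inv_mul_cancel₀ (norm_ne_zero_iff.2 (hv i))]
    conv_lhs => rw [h1]
    rw [T.map_smul_univ, norm_smul, norm_prod, mul_comm]
    simp only [RCLike.norm_ofReal, abs_norm]
    exact mul_le_mul_of_nonneg_right h2 (Finset.prod_nonneg fun i _ => norm_nonneg _)

lemma norm_diagonalForm_le {m : ℕ} (hm : 0 < m) {q s C S : ℝ} (hq : 0 < q)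
    (h : ℕ → X →L[𝕂] 𝕂) (hh : ∀ j v, ‖h j v‖ ≤ ‖v‖) {F : Finset ℕ} {y : ℕ → Y} (hC : 0 ≤ C)
    (hS0 : 0 ≤ S) (hS : ∀ v, ‖v‖ ≤ 1 → ∑ j ∈ F, ‖h j v‖ ^ ((m : ℝ) * q) ≤ S)
    (hy : ∀ (b : ℕ → 𝕂) (S : ℝ), (∀ j, ‖b j‖ ≤ 1) → ∑ j ∈ F, ‖b j‖ ^ q ≤ S →
      ‖∑ j ∈ F, b j • y j‖ ≤ C * S ^ (1 / s)) :
    ‖diagonalForm m h F y‖ ≤ C * (m * S) ^ (1 / s) := by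
  refine ContinuousMultilinearMap.opNorm_le_of_forall_norm_le_one _ (by positivity) fun v hv => ?_
  rw [diagonalForm_apply]
  refine hy _ _ (fun j => ?_) ?_
  · rw [norm_prod]
    exact Finset.prod_le_one (fun i _ => norm_nonneg _) fun i _ => (hh j _).trans (hv i)
  · calc ∑ j ∈ F, ‖∏ i, h j (v i)‖ ^ q
        ≤ ∑ j ∈ F, ∑ i, ‖h j (v i)‖ ^ ((m : ℝ) * q) := Finset.sum_le_sum fun j _ => by
          rw [norm_prod]
          exact prod_rpow_le_sum_rpow hm hq _ fun i => norm_nonneg _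
      _ = ∑ i, ∑ j ∈ F, ‖h j (v i)‖ ^ ((m : ℝ) * q) := Finset.sum_comm
      _ ≤ ∑ _i : Fin m, S := Finset.sum_le_sum fun i _ => hS _ (hv i)
      _ = m * S := by simp

/-- The supremum of `∑ j ∈ F, ‖h j v‖ ^ p` over the unit ball is nearly attained. -/
lemma exists_norming_vector {p : ℝ} (hp : 0 < p) (h : ℕ → X →L[𝕂] 𝕂)
    (hh : ∀ j v, ‖h j v‖ ≤ ‖v‖) (F : Finset ℕ) {x : X} (hx : ‖x‖ ≤ 1)
    (hpos : 0 < ∑ j ∈ F, ‖h j x‖ ^ p) :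
    ∃ S, ∑ j ∈ F, ‖h j x‖ ^ p ≤ S ∧ (∀ v, ‖v‖ ≤ 1 → ∑ j ∈ F, ‖h j v‖ ^ p ≤ S) ∧
      ∃ v, ‖v‖ ≤ 1 ∧ S / 2 ≤ ∑ j ∈ F, ‖h j v‖ ^ p := by
  set A : Set ℝ := (fun v => ∑ j ∈ F, ‖h j v‖ ^ p) '' {v | ‖v‖ ≤ 1} with hA
  have hbdd : BddAbove A := by
    refine ⟨F.card, ?_⟩
    rintro _ ⟨v, hv, rfl⟩
    simpa using Finset.sum_le_card_nsmul F (fun j => ‖h j v‖ ^ p) 1 fun j _ =>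
      Real.rpow_le_one (norm_nonneg _) ((hh j v).trans hv) hp.le
  have hxA : ∑ j ∈ F, ‖h j x‖ ^ p ∈ A := ⟨x, hx, rfl⟩
  have hxS := le_csSup hbdd hxA
  obtain ⟨_, ⟨v, hv, rfl⟩, hlt⟩ := exists_lt_of_lt_csSup ⟨_, hxA⟩
    (show sSup A / 2 < sSup A by linarith)
  exact ⟨sSup A, hxS, fun v hv => le_csSup hbdd ⟨v, hv, rfl⟩, v, hv, hlt.le⟩

end DiagonalForms

section GlidingHump

variable {𝕂 : Type*} [RCLike 𝕂] {X Y : Type*} [NormedAddCommGroup X] [NormedSpace 𝕂 X]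
  [NormedAddCommGroup Y] [NormedSpace 𝕂 Y]

/-- If all `m`-homogeneous polynomials are absolutely `(q; 1)`-summing, then the coordinates of
every vector of norm at most one are `m q`-summable. -/
lemma summable_coord_rpow_of_norm_le_one [CompleteSpace X] [CompleteSpace Y] {e : ℕ → X}
    (he : IsNormalizedUncondBasis 𝕂 X e) {m : ℕ} (hm : 0 < m) {q : ℝ} (hq : 0 < q)
    (hsum : ∀ P : X → Y, IsHomogPoly 𝕂 m P → ∀ x : ℕ → X, WeaklySummable 𝕂 x →
      Summable fun j => ‖P (x j)‖ ^ q)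
    (hUF : HasUpperFamilies 𝕂 Y q) {x : X} (hx : ‖x‖ ≤ 1) {a : ℕ → 𝕂}
    (ha : HasSum (fun j => a j • e j) x) : Summable fun j => ‖a j‖ ^ ((m : ℝ) * q) := by
  classical
  obtain ⟨g, R, hR, huniq, hexp, hgR, hFR⟩ := he.exists_coord
  have hm' : (0 : ℝ) < m := by exact_mod_cast hm
  have hmq : 0 < (m : ℝ) * q := by positivity
  have hdelta : ∀ i j, g i (e j) = if i = j then 1 else 0 := fun i j => by
    refine (huniq (e j) (fun i => if i = j then 1 else 0) ?_ i).symm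
    convert hasSum_ite_eq j (e j) using 2 with i
    split_ifs with hij <;> simp [hij]
  set h : ℕ → X →L[𝕂] 𝕂 := fun j => ((R⁻¹ : ℝ) : 𝕂) • g j with hh_def
  have hh_norm : ∀ j v, ‖h j v‖ = R⁻¹ * ‖g j v‖ := fun j v => by
    rw [hh_def, smul_apply, norm_smul, RCLike.norm_ofReal,
      abs_of_pos (by positivity)]
  have hh : ∀ j v, ‖h j v‖ ≤ ‖v‖ := fun j v => by
    rw [hh_norm, inv_mul_le_iff₀ hR]
    exact hgR j v
  suffices hs : Summable fun j => ‖h j x‖ ^ ((m : ℝ) * q) by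
    refine (hs.mul_left (R ^ ((m : ℝ) * q))).congr fun j => ?_
    rw [hh_norm, ← Real.mul_rpow hR.le (by positivity), huniq x a ha j, mul_inv_cancel_left₀ hR.ne']
  by_contra hns
  obtain ⟨s, C, hqs, hC, hfam⟩ := hUF.exists_on_finset
  choose M hM0 hM using fun k : ℕ => exists_forall_ge_one_le_rpow
    (A := (1 / 2 : ℝ) ^ k * ((1 / 2 : ℝ) ^ k) ^ m / C) (c := m) (q := q) (s := s)
    (by positivity) hm' hq hqs
  obtain ⟨F, hFdisj, hF⟩ := exists_disjoint_blocks
    (fun j => Real.rpow_nonneg (norm_nonneg (h j x)) _) hns M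
  choose S hxS hS v hv hvS using fun k => exists_norming_vector hmq h hh (F k) hx
    ((hM0 k).trans_le (hF k))
  choose y hy hyb using fun k => hfam (F k)
  have hS0 : ∀ k, 0 < S k := fun k => (hM0 k).trans_le ((hF k).trans (hxS k))
  set K : ℕ → ℝ := fun k => C * (m * S k) ^ (1 / s) with hK
  have hK0 : ∀ k, 0 < K k := fun k => by
    have := hS0 k
    positivity
  have hgeom : Summable fun k : ℕ => (1 / 2 : ℝ) ^ k := summable_geometric_two
  set U : ℕ → ContinuousMultilinearMap 𝕂 (fun _ : Fin m => X) Y := fun k =>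
    (((1 / 2 : ℝ) ^ k / K k : ℝ) : 𝕂) • diagonalForm m h (F k) (y k) with hU
  have hUsum : Summable U := by
    refine Summable.of_norm_bounded hgeom fun k => ?_
    rw [hU, norm_smul, RCLike.norm_ofReal, abs_of_pos (div_pos (by positivity) (hK0 k)),
      div_mul_eq_mul_div, div_le_iff₀ (hK0 k)]
    exact mul_le_mul_of_nonneg_left
      (norm_diagonalForm_le hm hq h hh hC.le (hS0 k).le (hS k) (hyb k)) (by positivity)
  set w : ℕ → X := fun k => (((1 / 2 : ℝ) ^ k : ℝ) : 𝕂) • ∑ j ∈ F k, g j (v k) • e j with hw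
  have hwsum : Summable w := by
    refine Summable.of_norm_bounded (hgeom.mul_right R) fun k => ?_
    rw [hw, norm_smul, RCLike.norm_ofReal, abs_of_pos (by positivity)]
    refine mul_le_mul_of_nonneg_left ((hFR _ _).trans ?_) (by positivity)
    exact mul_le_of_le_one_right hR.le (hv k)
  have hmem : ∀ k l j, j ∈ F k → l ≠ k → j ∉ F l := fun k l j hj hlk hj' =>
    Finset.disjoint_left.1 (hFdisj l k hlk) hj' hj
  have hgw : ∀ k, ∀ j ∈ F k, g j (∑' l, w l) = (((1 / 2 : ℝ) ^ k : ℝ) : 𝕂) * g j (v k) := by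
    intro k j hj
    have hval : ∀ l, g j (w l) =
        if j ∈ F l then (((1 / 2 : ℝ) ^ l : ℝ) : 𝕂) * g j (v l) else 0 := by
      intro l
      simp [hw, hdelta]
    rw [(g j).map_tsum hwsum, tsum_eq_single k fun l hl => by rw [hval, if_neg (hmem k l j hj hl)],
      hval, if_pos hj]
  set z : ℕ → X := fun j => g j (∑' l, w l) • e j with hz
  have hzsum := hsum (fun u => (∑' k, U k) fun _ => u) ⟨∑' k, U k, fun _ => rfl⟩ z
    (weaklySummable_of_hasSum (hexp _))
  refine not_summable_of_disjoint_blocks (fun j => Real.rpow_nonneg (norm_nonneg _) q) hFdisj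
    (fun k => ?_) hzsum
  have hP : ∀ j ∈ F k, ((1 / 2 : ℝ) ^ k * ((1 / 2 : ℝ) ^ k) ^ m / C / (m * S k) ^ (1 / s)) *
      ‖h j (v k)‖ ^ m ≤ ‖(∑' k, U k) fun _ => z j‖ := by
    intro j hj
    have hhz : ∀ i, h i (z j) = if i = j then (((1 / 2 : ℝ) ^ k : ℝ) : 𝕂) * h j (v k) else 0 := by
      intro i
      simp only [hh_def, hz, map_smul, hgw k j hj, hdelta, smul_apply,
        smul_eq_mul]
      split_ifs with hij
      · ring
      · simp
    have hUz : ∀ l, U l (fun _ => z j) = if l = k then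
        ((((1 / 2 : ℝ) ^ k / K k : ℝ) : 𝕂) * ((((1 / 2 : ℝ) ^ k : ℝ) : 𝕂) * h j (v k)) ^ m) • y k j
        else 0 := by
      intro l
      rw [hU, smul_apply, diagonalForm_apply]
      simp only [hhz, Finset.prod_const, Finset.card_univ, Fintype.card_fin, ite_pow,
        zero_pow hm.ne', ite_smul, zero_smul, Finset.sum_ite_eq']
      by_cases hl : l = k
      · subst hl
        rw [if_pos hj, if_pos rfl, smul_smul]
      · rw [if_neg (hmem k l j hj hl), if_neg hl, smul_zero]
    have hT : (∑' l, U l) (fun _ => z j) =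
        ((((1 / 2 : ℝ) ^ k / K k : ℝ) : 𝕂) * ((((1 / 2 : ℝ) ^ k : ℝ) : 𝕂) * h j (v k)) ^ m) •
          y k j := by
      have h1 : (∑' l, U l) (fun _ => z j) = ∑' l, U l (fun _ => z j) :=
        (ContinuousMultilinearMap.apply 𝕂 (fun _ : Fin m => X) Y fun _ => z j).map_tsum hUsum
      rw [h1, tsum_eq_single k fun l hl => by rw [hUz, if_neg hl], hUz, if_pos rfl]
    rw [hT, norm_smul, norm_mul, norm_pow, norm_mul, RCLike.norm_ofReal, RCLike.norm_ofReal,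
      abs_of_pos (div_pos (by positivity) (hK0 k)),
      abs_of_pos (show (0 : ℝ) < (1 / 2) ^ k by positivity)]
    have hpos : 0 ≤ (1 / 2 : ℝ) ^ k / K k * ((1 / 2 : ℝ) ^ k * ‖h j (v k)‖) ^ m :=
      mul_nonneg (div_nonneg (by positivity) (hK0 k).le) (by positivity)
    refine le_trans (le_of_eq ?_) (le_mul_of_one_le_right hpos (hy k j hj))
    rw [hK, mul_pow, div_div]
    ring
  have hA0 : 0 ≤ (1 / 2 : ℝ) ^ k * ((1 / 2 : ℝ) ^ k) ^ m / C / (m * S k) ^ (1 / s) := by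
    have := hS0 k
    positivity
  refine (hM k (S k) ((hF k).trans (hxS k))).trans ?_
  refine (mul_le_mul_of_nonneg_left (hvS k) (Real.rpow_nonneg hA0 q)).trans ?_
  rw [Finset.mul_sum]
  refine Finset.sum_le_sum fun j hj => ?_
  rw [Real.rpow_mul (norm_nonneg _), Real.rpow_natCast, ← Real.mul_rpow hA0 (by positivity)]
  exact Real.rpow_le_rpow (mul_nonneg hA0 (by positivity)) (hP j hj) hq.le

end GlidingHump
/-- Botelho–Pellegrino: polynomial case. -/
theorem stmt16 (𝕂 : Type*) [RCLike 𝕂]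
    (X : Type*) [NormedAddCommGroup X] [NormedSpace 𝕂 X] [CompleteSpace X]
    (hX : ¬FiniteDimensional 𝕂 X)
    (e : ℕ → X) (he : IsNormalizedUncondBasis 𝕂 X e)
    (m : ℕ) (hm : 0 < m) (q : ℝ) (hq : 0 < q)
    (Y : Type*) [NormedAddCommGroup Y] [NormedSpace 𝕂 Y] [CompleteSpace Y]
    (hsum : ∀ P : X → Y, IsHomogPoly 𝕂 m P → ∀ x : ℕ → X, WeaklySummable 𝕂 x →
      Summable fun j => ‖P (x j)‖ ^ q)
    (hY : (q < 1 ∧ Nontrivial Y ∧ FiniteDimensional 𝕂 Y) ∨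
      (¬FiniteDimensional 𝕂 Y ∧ ∃ s : ℝ, 2 ≤ s ∧ q < s ∧ ¬HasCotype Y s))
    (t : ℝ) (ht : q < t) (x : X) (a : ℕ → 𝕂)
    (ha : HasSum (fun j => a j • e j) x) :
    Summable fun j => ‖a j‖ ^ ((m : ℝ) * t) := by
  have hUF : HasUpperFamilies 𝕂 Y q := by
    rcases hY with ⟨hq1, _, -⟩ | ⟨hYinf, s, hs, hqs, hcot⟩
    · exact hasUpperFamilies_of_lt_one hq hq1
    · rcases lt_or_ge q 2 with hq2 | hq2
      · exact hasUpperFamilies_of_lt_two hYinf hq hq2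
      · exact hasUpperFamilies_of_not_hasCotype hq hqs (hq2.trans_lt hqs) hcot
  have hm' : (0 : ℝ) < m := by exact_mod_cast hm
  set r : ℝ := (1 + ‖x‖)⁻¹ with hr
  have hr0 : 0 < r := by positivity
  have hrx : ‖(r : 𝕂) • x‖ ≤ 1 := by
    rw [norm_smul, RCLike.norm_ofReal, abs_of_pos hr0, hr, inv_mul_le_iff₀ (by positivity)]
    linarith
  have hra : HasSum (fun j => ((r : 𝕂) * a j) • e j) ((r : 𝕂) • x) := by
    simpa only [mul_smul] using ha.const_smul (r : 𝕂)
  have h1 : Summable fun j => ‖a j‖ ^ ((m : ℝ) * q) := by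
    refine ((summable_coord_rpow_of_norm_le_one he hm hq hsum hUF hrx hra).mul_left
      (r⁻¹ ^ ((m : ℝ) * q))).congr fun j => ?_
    rw [norm_mul, RCLike.norm_ofReal, abs_of_pos hr0,
      ← Real.mul_rpow (by positivity) (by positivity), inv_mul_cancel_left₀ hr0.ne']
  refine Summable.of_norm_bounded_eventually_nat h1 ?_
  have hlim := h1.tendsto_atTop_zero
  filter_upwards [hlim.eventually_lt_const zero_lt_one] with j hj
  have hj1 : ‖a j‖ ≤ 1 := by
    by_contra! hcon
    exact absurd hj (not_lt.2 (Real.one_le_rpow hcon.le (by positivity)))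
  rw [Real.norm_of_nonneg (by positivity)]
  exact Real.rpow_le_rpow_of_exponent_ge' (norm_nonneg _) hj1 (by positivity)
    (mul_le_mul_of_nonneg_left ht.le hm'.le)
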